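/- Let G be a candidate and let C be a shortest long even hole in G. Then C has no shortcut; that is, for all distinct nonadjacent u, v ∈ V(C), there is no uv-path Q in G such that V(Q) contains no C-major vertex and |E(Q)| < d_C(u,v). -/

import Mathlib

open SimpleGraph

namespace LEH

open scoped Classical

variable {V : Type*}

/-- `X` is anticomplete to `Y`: they are disjoint and there are no edges between them. -/
def Anticomplete (G : SimpleGraph V) (X Y : Set V) : Prop :=
  ∀ ⦃x⦄, x ∈ X → ∀ ⦃y⦄, y ∈ Y → x ≠ y ∧ ¬ G.Adj x y

/-- The vertex set of a walk. -/
def vset {G : SimpleGraph V} {u v : V} (P : G.Walk u v) : Set V :=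
  {x | x ∈ P.support}

/-- The interior of a path: its non-end vertices. -/
def inter {G : SimpleGraph V} {u v : V} (P : G.Walk u v) : Set V :=
  {x | x ∈ P.support ∧ x ≠ u ∧ x ≠ v}

/-- An induced path in `G`. -/
def IsInducedPath {G : SimpleGraph V} {u v : V} (P : G.Walk u v) : Prop :=
  P.IsPath ∧ ∀ x ∈ P.support, ∀ y ∈ P.support, G.Adj x y → s(x, y) ∈ P.edges

/-- A hole: an induced cycle of length at least 4. -/
def IsHole {G : SimpleGraph V} {u : V} (c : G.Walk u u) : Prop :=
  c.IsCycle ∧ 4 ≤ c.length ∧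
    ∀ x ∈ c.support, ∀ y ∈ c.support, G.Adj x y → s(x, y) ∈ c.edges

/-- A long even hole: a hole of even length at least `ℓ`. -/
def IsLongEvenHole (ℓ : ℕ) {G : SimpleGraph V} {u : V} (c : G.Walk u u) : Prop :=
  IsHole c ∧ ℓ ≤ c.length ∧ Even c.length

def HasLongEvenHole (G : SimpleGraph V) (ℓ : ℕ) : Prop :=
  ∃ (u : V) (c : G.Walk u u), IsLongEvenHole ℓ c

/-- A long theta in `G`: two nonadjacent vertices joined by three internally disjoint
induced paths with no edges between their interiors, any two of which form a long hole. -/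
def HasLongTheta (G : SimpleGraph V) (ℓ : ℕ) : Prop :=
  ∃ (u v : V) (P₁ P₂ P₃ : G.Walk u v),
    u ≠ v ∧ ¬ G.Adj u v ∧
    IsInducedPath P₁ ∧ IsInducedPath P₂ ∧ IsInducedPath P₃ ∧
    Anticomplete G (inter P₁) (inter P₂) ∧
    Anticomplete G (inter P₁) (inter P₃) ∧
    Anticomplete G (inter P₂) (inter P₃) ∧
    ℓ ≤ P₁.length + P₂.length ∧ ℓ ≤ P₁.length + P₃.length ∧
    ℓ ≤ P₂.length + P₃.length

/-- A long jewel of order `k` formed by `Q₁, Q₂, P`. -/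
def IsLongJewel (ℓ k : ℕ) {G : SimpleGraph V} {u v : V}
    (Q₁ Q₂ P : G.Walk u v) : Prop :=
  u ≠ v ∧
  IsInducedPath Q₁ ∧ IsInducedPath Q₂ ∧ IsInducedPath P ∧
  ¬ (Even Q₁.length ↔ Even Q₂.length) ∧
  max Q₁.support.length Q₂.support.length = k ∧
  ℓ ≤ P.length + min Q₁.length Q₂.length ∧
  Anticomplete G (inter P) (inter Q₁ ∪ inter Q₂)

def HasLongJewel (G : SimpleGraph V) (ℓ k : ℕ) : Prop :=
  ∃ (u v : V) (Q₁ Q₂ P : G.Walk u v), IsLongJewel ℓ k Q₁ Q₂ P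

/-- A long ban-the-bomb in `G`. -/
def IsLongBanTheBomb (ℓ : ℕ) {G : SimpleGraph V} (u v₁ w v₂ x : V)
    (P₁ : G.Walk x v₁) (P₂ : G.Walk x v₂) : Prop :=
  G.Adj u v₁ ∧ G.Adj v₁ w ∧ G.Adj w v₂ ∧ G.Adj v₂ u ∧ ¬ G.Adj v₁ v₂ ∧ u ≠ w ∧
  G.Adj x u ∧ ¬ G.Adj x v₁ ∧ ¬ G.Adj x v₂ ∧ ¬ G.Adj x w ∧
  x ≠ v₁ ∧ x ≠ v₂ ∧ x ≠ w ∧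
  IsInducedPath P₁ ∧ IsInducedPath P₂ ∧
  2 ≤ P₁.length ∧ 2 ≤ P₂.length ∧
  Anticomplete G (inter P₁) {u, w} ∧ Anticomplete G (inter P₂) {u, w} ∧
  Anticomplete G (vset P₁ \ {x}) (vset P₂ \ {x}) ∧
  ℓ ≤ P₁.length + 2 ∧ ℓ ≤ P₂.length + 2 ∧ ℓ ≤ P₁.length + P₂.length + 2

def HasLongBanTheBomb (G : SimpleGraph V) (ℓ : ℕ) : Prop :=
  ∃ (u v₁ w v₂ x : V) (P₁ : G.Walk x v₁) (P₂ : G.Walk x v₂),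
    IsLongBanTheBomb ℓ u v₁ w v₂ x P₁ P₂

/-- The induced subgraph of `G` on the vertex set `S` is a long hole. -/
def IsLongHoleOn (G : SimpleGraph V) (ℓ : ℕ) (S : Set V) : Prop :=
  ∃ (u : V) (c : G.Walk u u), IsHole c ∧ ℓ ≤ c.length ∧ {x | x ∈ c.support} = S

/-- A long near-prism with triangles `{a 0, a 1, a 2}`, `{b 0, b 1, b 2}` and
constituent paths `P 0, P 1, P 2`. -/
def IsLongNearPrism (ℓ : ℕ) {G : SimpleGraph V} (a b : Fin 3 → V)
    (P : ∀ i : Fin 3, G.Walk (a i) (b i)) : Prop :=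
  (∀ i j, i ≠ j → G.Adj (a i) (a j)) ∧
  (∀ i j, i ≠ j → G.Adj (b i) (b j)) ∧
  (Set.range a ∩ Set.range b).Subsingleton ∧
  (∀ i, (P i).IsPath) ∧
  (∀ i j, i ≠ j → ∀ x, x ∈ (P i).support → x ∉ (P j).support) ∧
  (∀ i j, i ≠ j → IsLongHoleOn G ℓ (vset (P i) ∪ vset (P j)))

def HasLongNearPrism (G : SimpleGraph V) (ℓ : ℕ) : Prop :=
  ∃ (a b : Fin 3 → V) (P : ∀ i : Fin 3, G.Walk (a i) (b i)), IsLongNearPrism ℓ a b P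

/-- A prospect: no long even hole of length at most `2ℓ`, no long jewel of order at most
`ℓ+1`, no long theta and no long ban-the-bomb. -/
def Prospect (G : SimpleGraph V) (ℓ : ℕ) : Prop :=
  (¬ ∃ (u : V) (c : G.Walk u u), IsLongEvenHole ℓ c ∧ c.length ≤ 2 * ℓ) ∧
  (¬ ∃ k ≤ ℓ + 1, HasLongJewel G ℓ k) ∧
  ¬ HasLongTheta G ℓ ∧ ¬ HasLongBanTheBomb G ℓ

/-- A candidate : a prospect with no long near-prism. -/
def Candidate (G : SimpleGraph V) (ℓ : ℕ) : Prop :=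
  Prospect G ℓ ∧ ¬ HasLongNearPrism G ℓ

/-- The vertex set of a near-prism. -/
def prismSupport {G : SimpleGraph V} {a b : Fin 3 → V}
    (P : ∀ i : Fin 3, G.Walk (a i) (b i)) : Set V :=
  ⋃ i, vset (P i)

/-- The near-prism, as a graph on `V`. -/
def prismGraph (G : SimpleGraph V) (a b : Fin 3 → V)
    (P : ∀ i : Fin 3, G.Walk (a i) (b i)) : SimpleGraph V :=
  SimpleGraph.fromEdgeSet
    ({e | ∃ i j, i ≠ j ∧ e = s(a i, a j)} ∪ {e | ∃ i j, i ≠ j ∧ e = s(b i, b j)} ∪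
      {e | ∃ i, e ∈ (P i).edges})

/-- `q` is `K`-major: `q` is outside the near-prism `K`, and no path of `K` with at most
three vertices contains all neighbours of `q` in `V(K)`. -/
def KMajor (G : SimpleGraph V) {a b : Fin 3 → V}
    (P : ∀ i : Fin 3, G.Walk (a i) (b i)) (q : V) : Prop :=
  q ∉ prismSupport P ∧
  ¬ ∃ (x y : V) (W : (prismGraph G a b P).Walk x y), W.IsPath ∧ W.length ≤ 2 ∧
      ∀ z ∈ prismSupport P, G.Adj q z → z ∈ W.support

/-- A shortest long near-prism. -/
def ShortestLNP (G : SimpleGraph V) (ℓ : ℕ) {a b : Fin 3 → V}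
    (P : ∀ i : Fin 3, G.Walk (a i) (b i)) : Prop :=
  IsLongNearPrism ℓ a b P ∧
  ∀ (a' b' : Fin 3 → V) (P' : ∀ i : Fin 3, G.Walk (a' i) (b' i)),
    IsLongNearPrism ℓ a' b' P' → (prismSupport P).ncard ≤ (prismSupport P').ncard

/-- The interior `F_K*` of the frame of a long near-prism: for each constituent path,
either the whole path (if it has length at most `ℓ-1`), or the non-end vertices of the
two stubs of length `ℓ/2 - 1` at its two ends. -/
def frameStar (ℓ : ℕ) {G : SimpleGraph V} {a b : Fin 3 → V}
    (P : ∀ i : Fin 3, G.Walk (a i) (b i)) : Set V :=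
  ⋃ i,
    if (P i).length ≤ ℓ - 1 then vset (P i)
    else {x | x ∈ (P i).support.take (ℓ / 2 - 1)} ∪
      {x | x ∈ (P i).support.reverse.take (ℓ / 2 - 1)}

/-- A long near-prism is tidy: it contains a frame (so at most one constituent path has
length at most `ℓ-1`) whose interior is anticomplete to the rest of the graph. -/
def Tidy (G : SimpleGraph V) (ℓ : ℕ) {a b : Fin 3 → V}
    (P : ∀ i : Fin 3, G.Walk (a i) (b i)) : Prop :=
  (∀ i j, (P i).length ≤ ℓ - 1 → (P j).length ≤ ℓ - 1 → i = j) ∧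
  Anticomplete G (frameStar ℓ P) {x | x ∉ prismSupport P}

/-- The index of the first neighbour of `x` in the list `l`. -/
noncomputable def firstNbrIdx (G : SimpleGraph V) (l : List V) (x : V) : ℕ :=
  l.findIdx (fun y => decide (G.Adj x y))

/-- `α(x)`: the neighbour of `x` on `P` nearest to the first end of `P`. -/
noncomputable def alpha (G : SimpleGraph V) {u w : V} (P : G.Walk u w) (x : V) : V :=
  P.support.getD (firstNbrIdx G P.support x) u

/-- `β(x)`: the neighbour of `x` on `P` nearest to the last end of `P`. -/
noncomputable def beta (G : SimpleGraph V) {u w : V} (P : G.Walk u w) (x : V) : V :=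
  P.support.reverse.getD (firstNbrIdx G P.support.reverse x) w

/-- `A(x)`: the vertex set of the subpath of `P` from its first end to `α(x)` if `x` has
a neighbour on `P`, and all of `V(P)` otherwise. -/
noncomputable def Aset (G : SimpleGraph V) {u w : V} (P : G.Walk u w) (x : V) : Set V :=
  if ∃ y ∈ P.support, G.Adj x y then
    {z | z ∈ P.support.take (firstNbrIdx G P.support x + 1)}
  else vset P

noncomputable def A123 (G : SimpleGraph V) {a b : Fin 3 → V}
    (P : ∀ i : Fin 3, G.Walk (a i) (b i)) (x : V) : Set V :=
  ⋃ i, Aset G (P i) x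

/-- The index of `v` in the list `l`. -/
noncomputable def listIdx (l : List V) (v : V) : ℕ :=
  l.findIdx (fun z => decide (z = v))

/-- `K^m_n(v)`: the union of the maximal subpath of `P` from `v` towards the first end of
`P` of length at most `m` with no internal vertex in `Fs`, and the maximal subpath of `P`
from `v` towards the last end of `P` of length at most `n` with no internal vertex in `Fs`. -/
noncomputable def Kmn (G : SimpleGraph V) (Fs : Set V) {u w : V}
    (P : G.Walk u w) (v : V) (m n : ℕ) : Set V :=
  let t := listIdx P.support v
  {z | ∃ r, r ≤ t ∧ t - r ≤ m ∧
      (∀ q, r < q → q < t → P.support.getD q v ∉ Fs) ∧ z = P.support.getD r v} ∪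
  {z | ∃ r, t ≤ r ∧ r < P.support.length ∧ r - t ≤ n ∧
      (∀ q, t < q → q < r → P.support.getD q v ∉ Fs) ∧ z = P.support.getD r v}

/-- `y` is distant from `x` (both `K`-major), for a tidy near-prism. -/
def Distant (G : SimpleGraph V) (ℓ : ℕ) {a b : Fin 3 → V}
    (P : ∀ i : Fin 3, G.Walk (a i) (b i)) (x y : V) : Prop :=
  ¬ G.Adj x y ∧
  (∃ z ∈ A123 G P x, G.Adj y z) ∧
  (∀ i, (∃ z ∈ (P i).support, G.Adj x z) →
    ∀ z ∈ Kmn G (frameStar ℓ P) (P i) (alpha G (P i) x) (ℓ - 2) 1, ¬ G.Adj y z) ∧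
  (∀ i, (¬ ∃ z ∈ (P i).support, G.Adj x z) →
    ∃ j, j ≠ i ∧
      ∀ z ∈ Kmn G (frameStar ℓ P) (P j) (beta G (P j) x) 0 (ℓ - 3), ¬ G.Adj y z)

/-- The hole `c`, regarded as a graph on `V`. -/
def holeGraph (G : SimpleGraph V) {u : V} (c : G.Walk u u) : SimpleGraph V :=
  SimpleGraph.fromEdgeSet {e | e ∈ c.edges}

/-- The distance between two vertices in the hole `c`. -/
noncomputable def holeDist (G : SimpleGraph V) {u : V} (c : G.Walk u u) (x y : V) : ℕ :=
  (holeGraph G c).dist x y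

/-- `x` is `C`-major for the hole `c`: `x` is not on `c` and no path of `c` with at most
three vertices contains all neighbours of `x` on `c`. -/
def CMajor (G : SimpleGraph V) {u : V} (c : G.Walk u u) (x : V) : Prop :=
  x ∉ c.support ∧
  ¬ ∃ q ∈ c.support, ∀ z ∈ c.support, G.Adj x z → z = q ∨ s(q, z) ∈ c.edges

/-- A shortest long even hole. -/
def ShortestLEH (G : SimpleGraph V) (ℓ : ℕ) {u : V} (c : G.Walk u u) : Prop :=
  IsLongEvenHole ℓ c ∧
  ∀ (v : V) (c' : G.Walk v v), IsLongEvenHole ℓ c' → c.length ≤ c'.length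

/-- `L₁, L₂` are the two `x y`-paths of the hole `c`. -/
def ArcPair {G : SimpleGraph V} {u : V} (c : G.Walk u u) {x y : V}
    (L₁ L₂ : G.Walk x y) : Prop :=
  L₁.IsPath ∧ L₂.IsPath ∧
  (∀ e ∈ L₁.edges, e ∈ c.edges) ∧ (∀ e ∈ L₂.edges, e ∈ c.edges) ∧
  (∀ e ∈ c.edges, e ∈ L₁.edges ∨ e ∈ L₂.edges) ∧
  (∀ e ∈ L₁.edges, e ∉ L₂.edges)

/-- `X` is lighter than `Y`, with respect to the linear order on edges given by `idx`. -/
def Lighter [DecidableEq V] (idx : Sym2 V → ℕ) (X Y : Finset (Sym2 V)) : Prop :=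
  X.card < Y.card ∨
  (X.card = Y.card ∧ ∃ e ∈ Y, e ∉ X ∧
    ∀ f : Sym2 V, ((f ∈ X ∧ f ∉ Y) ∨ (f ∈ Y ∧ f ∉ X)) → idx e ≤ idx f)

/-- The lightest long even hole. -/
def LightestLEH [DecidableEq V] (G : SimpleGraph V) (ℓ : ℕ) (idx : Sym2 V → ℕ)
    {u : V} (c : G.Walk u u) : Prop :=
  IsLongEvenHole ℓ c ∧
  ∀ (v : V) (c' : G.Walk v v), IsLongEvenHole ℓ c' →
    c'.edges.toFinset ≠ c.edges.toFinset →
    Lighter idx c.edges.toFinset c'.edges.toFinset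

/-- A `(C,x)`-gap: a path of the hole `c` of length at least two whose ends are adjacent
to `x` and none of whose interior vertices is adjacent to `x`. -/
def IsGap (G : SimpleGraph V) {u : V} (c : G.Walk u u) (x : V) {p₁ p₂ : V}
    (P : G.Walk p₁ p₂) : Prop :=
  P.IsPath ∧ (∀ e ∈ P.edges, e ∈ c.edges) ∧ 2 ≤ P.length ∧
  G.Adj x p₁ ∧ G.Adj x p₂ ∧ ∀ z ∈ inter P, ¬ G.Adj x z

end LEH

open LEH

namespace LEH.Indexed

variable {V : Type*} {G : SimpleGraph V}

/-- `g`, restricted to the integer interval `[x, y]`, enumerates an induced path of `G`. -/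
def IndPath (G : SimpleGraph V) (x y : ℤ) (g : ℤ → V) : Prop :=
  ∀ i j, x ≤ i → i < j → j ≤ y → g i ≠ g j ∧ (G.Adj (g i) (g j) ↔ j = i + 1)

/-- `f` is an `n`-periodic enumeration of a hole of length `n`. -/
def HoleFn (G : SimpleGraph V) (n : ℤ) (f : ℤ → V) : Prop :=
  4 ≤ n ∧ (∀ i, f (i + n) = f i) ∧
  ∀ i j, i < j → j < i + n → f i ≠ f j ∧ (G.Adj (f i) (f j) ↔ j = i + 1 ∨ j = i + n - 1)

lemma exists_path_of_fn {x y : ℤ} {g : ℤ → V} (hxy : x ≤ y)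
    (hadj : ∀ i, x ≤ i → i < y → G.Adj (g i) (g (i + 1)))
    (hinj : ∀ i j, x ≤ i → i < j → j ≤ y → g i ≠ g j) :
    ∃ P : G.Walk (g x) (g y), P.IsPath ∧ (P.length : ℤ) = y - x ∧
      (∀ z, z ∈ P.support ↔ ∃ i, x ≤ i ∧ i ≤ y ∧ z = g i) ∧
      (∀ e, e ∈ P.edges ↔ ∃ i, x ≤ i ∧ i < y ∧ e = s(g i, g (i + 1))) := by
  obtain ⟨m, rfl⟩ : ∃ m : ℕ, y = x + m := ⟨(y - x).toNat, by omega⟩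
  clear hxy
  induction m generalizing x with
  | zero =>
    refine ⟨(Walk.nil : G.Walk (g x) (g x)).copy rfl (by simp), by simp, by simp, ?_, ?_⟩
    · intro z
      simp only [Walk.support_copy, Walk.support_nil, List.mem_singleton]
      constructor
      · rintro rfl; exact ⟨x, by omega, by omega, rfl⟩
      · rintro ⟨i, h1, h2, rfl⟩; congr 1; push_cast at h2; omega
    · intro e
      simp only [Walk.edges_copy, Walk.edges_nil, List.not_mem_nil, false_iff]
      rintro ⟨i, h1, h2, -⟩; push_cast at h2; omega
  | succ m ih =>
    have e1 : x + ((m + 1 : ℕ) : ℤ) = x + 1 + m := by push_cast; ring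
    rw [e1] at hadj hinj ⊢
    obtain ⟨P, hP, hl, hs, he⟩ := ih (x := x + 1) (fun i h1 h2 => hadj i (by omega) h2)
      (fun i j h1 h2 h3 => hinj i j (by omega) h2 h3)
    refine ⟨Walk.cons (hadj x (by omega) (by omega)) P, ?_, ?_, ?_, ?_⟩
    · rw [Walk.cons_isPath_iff]
      refine ⟨hP, fun hx => ?_⟩
      obtain ⟨i, h1, h2, h3⟩ := (hs _).1 hx
      exact hinj x i (by omega) (by omega) (by omega) h3
    · rw [Walk.length_cons]; push_cast; omega
    · intro z
      rw [Walk.support_cons, List.mem_cons, hs]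
      constructor
      · rintro (rfl | ⟨i, h1, h2, rfl⟩)
        · exact ⟨x, by omega, by omega, rfl⟩
        · exact ⟨i, by omega, by omega, rfl⟩
      · rintro ⟨i, h1, h2, rfl⟩
        rcases eq_or_lt_of_le h1 with rfl | h
        · exact Or.inl rfl
        · exact Or.inr ⟨i, by omega, by omega, rfl⟩
    · intro e
      rw [Walk.edges_cons, List.mem_cons, he]
      constructor
      · rintro (rfl | ⟨i, h1, h2, rfl⟩)
        · exact ⟨x, by omega, by omega, rfl⟩
        · exact ⟨i, by omega, by omega, rfl⟩
      · rintro ⟨i, h1, h2, rfl⟩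
        rcases eq_or_lt_of_le h1 with rfl | h
        · exact Or.inl rfl
        · exact Or.inr ⟨i, by omega, by omega, rfl⟩

lemma IndPath.exists_walk {x y : ℤ} {g : ℤ → V} (h : IndPath G x y g) (hxy : x ≤ y)
    {a b : V} (ha : g x = a) (hb : g y = b) :
    ∃ P : G.Walk a b, IsInducedPath P ∧ (P.length : ℤ) = y - x ∧
      (∀ z, z ∈ P.support ↔ ∃ i, x ≤ i ∧ i ≤ y ∧ z = g i) ∧
      (∀ z, z ∈ inter P ↔ ∃ i, x < i ∧ i < y ∧ z = g i) := by
  subst ha hb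
  obtain ⟨P, hP, hl, hs, he⟩ := exists_path_of_fn (G := G) hxy
    (fun i h1 h2 => ((h i (i + 1) h1 (by omega) (by omega)).2).2 rfl)
    (fun i j h1 h2 h3 => (h i j h1 h2 h3).1)
  refine ⟨P, ⟨hP, ?_⟩, hl, hs, ?_⟩
  · have key : ∀ i j, x ≤ i → i < j → j ≤ y → G.Adj (g i) (g j) → s(g i, g j) ∈ P.edges := by
      intro i j h1 h2 h3 h4
      obtain rfl := ((h i j h1 h2 h3).2).1 h4
      exact (he _).2 ⟨i, h1, by omega, rfl⟩
    intro a ha b hb hab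
    obtain ⟨i, h1, h2, rfl⟩ := (hs _).1 ha
    obtain ⟨j, h3, h4, rfl⟩ := (hs _).1 hb
    rcases lt_trichotomy i j with h5 | rfl | h5
    · exact key i j h1 h5 h4 hab
    · exact absurd rfl hab.ne
    · rw [Sym2.eq_swap]; exact key j i h3 h5 h2 hab.symm
  · intro z
    constructor
    · rintro ⟨h1, h2, h3⟩
      obtain ⟨i, h4, h5, rfl⟩ := (hs _).1 h1
      refine ⟨i, ?_, ?_, rfl⟩
      · rcases eq_or_lt_of_le h4 with rfl | h6
        · exact absurd rfl h2
        · exact h6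
      · rcases eq_or_lt_of_le h5 with rfl | h6
        · exact absurd rfl h3
        · exact h6
    · rintro ⟨i, h1, h2, rfl⟩
      exact ⟨(hs _).2 ⟨i, h1.le, h2.le, rfl⟩, ((h x i le_rfl h1 h2.le).1).symm,
        (h i y h1.le h2 le_rfl).1⟩

lemma IndPath.mono {x y x' y' : ℤ} {g : ℤ → V} (h : IndPath G x y g) (hx : x ≤ x')
    (hy : y' ≤ y) : IndPath G x' y' g :=
  fun i j h1 h2 h3 => h i j (by omega) h2 (by omega)

lemma IndPath.shift {x y : ℤ} {g : ℤ → V} (h : IndPath G x y g) (r : ℤ) :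
    IndPath G (x - r) (y - r) (fun i => g (i + r)) := by
  intro i j h1 h2 h3
  have := h (i + r) (j + r) (by omega) (by omega) (by omega)
  refine ⟨this.1, this.2.trans ⟨fun _ => by omega, fun _ => by omega⟩⟩

lemma IndPath.reflect {x y : ℤ} {g : ℤ → V} (h : IndPath G x y g) (r : ℤ) :
    IndPath G (r - y) (r - x) (fun i => g (r - i)) := by
  intro i j h1 h2 h3
  have := h (r - j) (r - i) (by omega) (by omega) (by omega)
  refine ⟨this.1.symm, (G.adj_comm _ _).trans (this.2.trans
    ⟨fun _ => by omega, fun _ => by omega⟩)⟩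

lemma HoleFn.shift {n : ℤ} {f : ℤ → V} (h : HoleFn G n f) (r : ℤ) :
    HoleFn G n (fun i => f (i + r)) := by
  refine ⟨h.1, fun i => ?_, fun i j h1 h2 => ?_⟩
  · have := h.2.1 (i + r)
    rwa [show i + r + n = i + n + r by ring] at this
  · have := h.2.2 (i + r) (j + r) (by omega) (by omega)
    exact ⟨this.1, this.2.trans ⟨fun _ => by omega, fun _ => by omega⟩⟩

lemma HoleFn.reflect {n : ℤ} {f : ℤ → V} (h : HoleFn G n f) (r : ℤ) :
    HoleFn G n (fun i => f (r - i)) := by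
  refine ⟨h.1, fun i => ?_, fun i j h1 h2 => ?_⟩
  · have := h.2.1 (r - (i + n))
    change f (r - (i + n)) = f (r - i)
    rw [← this]; congr 1; ring
  · have := h.2.2 (r - j) (r - i) (by omega) (by omega)
    exact ⟨this.1.symm, (G.adj_comm _ _).trans (this.2.trans
      ⟨fun _ => by omega, fun _ => by omega⟩)⟩

lemma HoleFn.sub_period {n : ℤ} {f : ℤ → V} (h : HoleFn G n f) (i : ℤ) : f (i - n) = f i := by
  have := h.2.1 (i - n)
  rw [← this]; congr 1; ring

lemma HoleFn.eq_of_eq_add {n : ℤ} {f : ℤ → V} (h : HoleFn G n f) {i j : ℤ} (hij : j = i + n) :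
    f j = f i := by
  subst hij; exact h.2.1 i

lemma HoleFn.emod {n : ℤ} {f : ℤ → V} (h : HoleFn G n f) (i : ℤ) : f (i % n) = f i := by
  have key : ∀ (k : ℕ) (j : ℤ), f (j + n * k) = f j := by
    intro k
    induction k with
    | zero => intro j; simp
    | succ k ih =>
      intro j
      rw [← ih j, ← h.2.1 (j + n * k)]; congr 1; push_cast; ring
  have h1 := Int.emod_add_mul_ediv i n
  rcases le_total 0 (i / n) with h2 | h2
  · obtain ⟨k, hk⟩ := Int.eq_ofNat_of_zero_le h2
    rw [← key k (i % n), ← hk, h1]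
  · obtain ⟨k, hk⟩ := Int.eq_ofNat_of_zero_le (show 0 ≤ -(i / n) by omega)
    rw [← key k i, ← hk]; congr 1; linear_combination h1

lemma HoleFn.exists_window {n : ℤ} {f : ℤ → V} (h : HoleFn G n f) (i r : ℤ) :
    ∃ j, r ≤ j ∧ j < r + n ∧ f i = f j := by
  have hn := h.1
  have h1 := Int.emod_nonneg (i - r) (show n ≠ 0 by omega)
  have h2 := Int.emod_lt_of_pos (i - r) (show 0 < n by omega)
  refine ⟨(i - r) % n + r, by omega, by omega, ?_⟩
  have := (h.shift r).emod (i - r)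
  simp only [sub_add_cancel] at this
  exact this.symm

lemma HoleFn.arc {n : ℤ} {f : ℤ → V} (h : HoleFn G n f) {x y : ℤ} (hxy : y ≤ x + n - 2) :
    IndPath G x y f := by
  intro i j h1 h2 h3
  have := h.2.2 i j h2 (by omega)
  exact ⟨this.1, this.2.trans ⟨fun _ => by omega, fun _ => by omega⟩⟩

lemma holeFn_of_window {n : ℤ} {g : ℤ → V} (hn : 4 ≤ n)
    (h : ∀ i j, 0 ≤ i → i < j → j < n →
      g i ≠ g j ∧ (G.Adj (g i) (g j) ↔ j = i + 1 ∨ (i = 0 ∧ j = n - 1))) :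
    ∃ f, HoleFn G n f ∧ ∀ i, 0 ≤ i → i < n → f i = g i := by
  refine ⟨fun i => g (i % n), ⟨hn, fun i => by simp, fun i j h1 h2 => ?_⟩,
    fun i h1 h2 => by simp only; rw [Int.emod_eq_of_lt h1 h2]⟩
  have h3 := Int.emod_nonneg i (show n ≠ 0 by omega)
  have h4 := Int.emod_lt_of_pos i (show 0 < n by omega)
  have e : j = i % n + (j - i) + n * (i / n) := by
    have := Int.emod_add_mul_ediv i n; linarith
  have e2 : j % n = (i % n + (j - i)) % n := by
    conv_lhs => rw [e]
    simp
  simp only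
  rw [e2]
  rcases lt_or_ge (i % n + (j - i)) n with h5 | h5
  · rw [Int.emod_eq_of_lt (by omega) h5]
    have := h (i % n) (i % n + (j - i)) h3 (by omega) h5
    exact ⟨this.1, this.2.trans ⟨fun _ => by omega, fun _ => by omega⟩⟩
  · have e3 : (i % n + (j - i)) % n = i % n + (j - i) - n := by
      rw [← Int.sub_emod_right, Int.emod_eq_of_lt (by omega) (by omega)]
    rw [e3]
    have := h (i % n + (j - i) - n) (i % n) (by omega) (by omega) h4
    exact ⟨this.1.symm, (G.adj_comm _ _).trans (this.2.trans
      ⟨fun _ => by omega, fun _ => by omega⟩)⟩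

lemma HoleFn.exists_walk {n : ℤ} {f : ℤ → V} (h : HoleFn G n f) :
    ∃ c : G.Walk (f 0) (f 0), IsHole c ∧ (c.length : ℤ) = n ∧
      ∀ z, z ∈ c.support ↔ ∃ i, z = f i := by
  have hn := h.1
  have hne : ∀ i j, 1 ≤ i → i < j → j ≤ n → f i ≠ f j := fun i j h1 h2 h3 =>
    (h.2.2 i j h2 (by omega)).1
  have hadj : ∀ i, G.Adj (f i) (f (i + 1)) := fun i =>
    ((h.2.2 i (i + 1) (by omega) (by omega)).2).2 (Or.inl rfl)
  obtain ⟨P, hP, hl, hs, he⟩ := exists_path_of_fn (G := G) (x := 1) (y := n) (g := f) (by omega)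
    (fun i _ _ => hadj i) hne
  have hn0 : f n = f 0 := by simpa using h.2.1 0
  have hl' : ((P.copy rfl hn0).length : ℤ) = n - 1 := by simpa using hl
  have hs' : ∀ z, z ∈ (P.copy rfl hn0).support ↔ ∃ i, 1 ≤ i ∧ i ≤ n ∧ z = f i := by simpa using hs
  have he' : ∀ e, e ∈ (P.copy rfl hn0).edges ↔ ∃ i, 1 ≤ i ∧ i < n ∧ e = s(f i, f (i + 1)) := by
    simpa using he
  have hP' : (P.copy rfl hn0).IsPath := by simpa using hP
  generalize P.copy rfl hn0 = P' at hl' hs' he' hP'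
  have hsup : ∀ z, z ∈ (Walk.cons (hadj 0) P').support ↔ ∃ i, z = f i := by
    intro z
    rw [Walk.support_cons, List.mem_cons]
    constructor
    · rintro (rfl | h1)
      · exact ⟨0, rfl⟩
      · obtain ⟨i, _, _, rfl⟩ := (hs' _).1 h1; exact ⟨i, rfl⟩
    · rintro ⟨i, rfl⟩
      obtain ⟨j, h1, h2, h3⟩ := h.exists_window i 1
      exact Or.inr ((hs' _).2 ⟨j, h1, by omega, h3⟩)
  refine ⟨Walk.cons (hadj 0) P', ⟨?_, ?_, ?_⟩, ?_, hsup⟩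
  · rw [Walk.cons_isCycle_iff]
    refine ⟨hP', fun h0 => ?_⟩
    obtain ⟨i, h1, h2, h3⟩ := (he' _).1 h0
    rw [← hn0] at h3
    rw [Sym2.eq_iff] at h3
    rcases h3 with ⟨h3, h4⟩ | ⟨h3, h4⟩
    · exact hne i n h1 h2 le_rfl h3.symm
    · rcases eq_or_ne i 1 with rfl | h6
      · exact hne 2 n (by omega) (by omega) le_rfl h3.symm
      · exact hne 1 i le_rfl (by omega) h2.le h4
  · rw [Walk.length_cons]; omega
  · have key : ∀ i j, 1 ≤ i → i < j → j ≤ n → G.Adj (f i) (f j) →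
        s(f i, f j) ∈ (Walk.cons (hadj 0) P').edges := by
      intro i j h1 h2 h3 h4
      rw [Walk.edges_cons, List.mem_cons, he']
      rcases ((h.2.2 i j h2 (by omega)).2).1 h4 with rfl | h5
      · exact Or.inr ⟨i, h1, by omega, rfl⟩
      · obtain rfl : i = 1 := by omega
        obtain rfl : j = n := by omega
        left; rw [hn0, Sym2.eq_swap]; rfl
    intro a ha b hb hab
    obtain ⟨i, rfl⟩ := (hsup _).1 ha
    obtain ⟨j, rfl⟩ := (hsup _).1 hb
    obtain ⟨i', h1, h2, h3⟩ := h.exists_window i 1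
    obtain ⟨j', h4, h5, h6⟩ := h.exists_window j 1
    rw [h3, h6] at hab ⊢
    rcases lt_trichotomy i' j' with h7 | rfl | h7
    · exact key i' j' h1 h7 (by omega) hab
    · exact absurd rfl hab.ne
    · rw [Sym2.eq_swap]; exact key j' i' h4 h7 (by omega) hab.symm
  · rw [Walk.length_cons]; push_cast; omega

/-- `z` lies on the hole `f`, or its neighbours on `f` are within a three-vertex subpath. -/
def NonMajor (G : SimpleGraph V) (f : ℤ → V) (z : V) : Prop :=
  (∃ i, z = f i) ∨ ∃ r, ∀ i, G.Adj z (f i) → f i = f r ∨ f i = f (r + 1) ∨ f i = f (r - 1)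

/-- The induced path `q 0, …, q m` joins two vertices `f 0` and `f t` of the hole `f`, and its
interior is anticomplete to the interior of the arc `f t, …, f n`. -/
structure Detour (G : SimpleGraph V) (n : ℤ) (f : ℤ → V) (t : ℤ) (q : ℤ → V) (m : ℤ) :
    Prop where
  hole : HoleFn G n f
  path : IndPath G 0 m q
  start_eq : q 0 = f 0
  end_eq : q m = f t
  one_le : 1 ≤ m
  two_le : 2 ≤ t
  le_sub : t ≤ n - 2
  anti : ∀ i j, 0 < i → i < m → t < j → j < n → q i ≠ f j ∧ ¬ G.Adj (q i) (f j)

lemma HoleFn.add_congr {n : ℤ} {f : ℤ → V} (hf : HoleFn G n f) {a b : ℤ} (hab : f a = f b)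
    (s : ℤ) : f (a + s) = f (b + s) := by
  have hn := hf.1
  have h : a % n = b % n := by
    by_contra hne
    have e4 := Int.emod_nonneg a (show n ≠ 0 by omega)
    have e5 := Int.emod_lt_of_pos a (show 0 < n by omega)
    have e6 := Int.emod_nonneg b (show n ≠ 0 by omega)
    have e7 := Int.emod_lt_of_pos b (show 0 < n by omega)
    rw [← hf.emod a, ← hf.emod b] at hab
    rcases lt_or_gt_of_ne hne with h | h
    · exact (hf.2.2 _ _ h (by omega)).1 hab
    · exact (hf.2.2 _ _ h (by omega)).1 hab.symm
  rw [← hf.emod (a + s), ← hf.emod (b + s), Int.add_emod, h, ← Int.add_emod]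

lemma exists_holeFn {u : V} {c : G.Walk u u} (hc : IsHole c) :
    ∃ f, HoleFn G c.length f ∧ (∀ z, z ∈ c.support ↔ ∃ i, z = f i) ∧
      ∀ e, e ∈ c.edges ↔ ∃ i, e = s(f i, f (i + 1)) := by
  obtain ⟨hcyc, h4, hch⟩ := hc
  have hinj : ∀ i j : ℕ, i < j → j < c.length → c.getVert i ≠ c.getVert j := by
    intro i j h1 h2 h3
    have := hcyc.getVert_injOn' (show i ≤ c.length - 1 by omega)
      (show j ≤ c.length - 1 by omega) h3
    omega
  have hw : ∀ i j : ℤ, 0 ≤ i → i < j → j < c.length →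
      c.getVert i.toNat ≠ c.getVert j.toNat ∧
      (G.Adj (c.getVert i.toNat) (c.getVert j.toNat) ↔
        j = i + 1 ∨ (i = 0 ∧ j = (c.length : ℤ) - 1)) := by
    intro i j h1 h2 h3
    lift i to ℕ using h1
    lift j to ℕ using (by omega)
    simp only [Int.toNat_natCast]
    refine ⟨hinj i j (by omega) (by omega), ?_, ?_⟩
    · intro hadj
      have he := hch _ (c.getVert_mem_support i) _ (c.getVert_mem_support j) hadj
      obtain ⟨k, hk, hk2⟩ := (Walk.mk_mem_edges_iff_exists _).1 he
      have inj' : ∀ a b : ℕ, a < c.length → b < c.length → c.getVert a = c.getVert b → a = b := by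
        intro a b ha hb hab
        rcases lt_trichotomy a b with h | h | h
        · exact absurd hab (hinj a b h hb)
        · exact h
        · exact absurd hab.symm (hinj b a h ha)
      rcases Nat.lt_or_ge (k + 1) c.length with hk3 | hk3
      · rw [Sym2.eq_iff] at hk2
        rcases hk2 with ⟨e1, e2⟩ | ⟨e1, e2⟩
        · have := inj' _ _ hk (by omega) e1
          have := inj' _ _ hk3 (by omega) e2
          omega
        · have := inj' _ _ hk (by omega) e1
          have := inj' _ _ hk3 (by omega) e2
          omega
      · have e0 : c.getVert (k + 1) = c.getVert 0 := by
          rw [Walk.getVert_of_length_le _ hk3, Walk.getVert_zero]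
        rw [e0, Sym2.eq_iff] at hk2
        rcases hk2 with ⟨e1, e2⟩ | ⟨e1, e2⟩
        · have := inj' _ _ hk (by omega) e1
          have := inj' _ _ (by omega) (by omega) e2
          omega
        · have := inj' _ _ hk (by omega) e1
          have := inj' _ _ (by omega) (by omega) e2
          omega
    · rintro (h | ⟨h, h'⟩)
      · obtain rfl : j = i + 1 := by omega
        exact c.adj_getVert_succ (by omega)
      · obtain rfl : i = 0 := by omega
        have := c.adj_getVert_succ (i := j) (by omega)
        rw [Walk.getVert_of_length_le _ (show c.length ≤ j + 1 by omega)] at this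
        rw [Walk.getVert_zero]; exact this.symm
  obtain ⟨f, hf, hfg⟩ := holeFn_of_window (G := G) (n := c.length)
    (g := fun i => c.getVert i.toNat) (by omega) hw
  have hfg' : ∀ k : ℕ, k ≤ c.length → f k = c.getVert k := by
    intro k hk
    rcases hk.lt_or_eq with hk | rfl
    · rw [hfg k (by omega) (by omega)]; simp
    · have := hf.2.1 0
      rw [zero_add] at this
      rw [this, hfg 0 le_rfl (by omega)]; simp
  refine ⟨f, hf, fun z => ?_, fun e => ?_⟩
  · rw [Walk.mem_support_iff_exists_getVert]
    constructor
    · rintro ⟨k, rfl, hk⟩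
      exact ⟨k, (hfg' k hk).symm⟩
    · rintro ⟨i, rfl⟩
      obtain ⟨j, h1, h2, h3⟩ := hf.exists_window i 0
      lift j to ℕ using h1
      exact ⟨j, by rw [h3, hfg' j (by omega)], by omega⟩
  · induction e using Sym2.ind with
    | _ a b =>
      rw [Walk.mk_mem_edges_iff_exists]
      constructor
      · rintro ⟨k, hk, hk2⟩
        refine ⟨k, ?_⟩
        rw [← hk2, hfg' k hk.le, ← hfg' (k + 1) hk]; simp
      · rintro ⟨i, hi⟩
        obtain ⟨j, h1, h2, h3⟩ := hf.exists_window i 0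
        have h4 : f (i + 1) = f (j + 1) := hf.add_congr h3 1
        lift j to ℕ using h1
        refine ⟨j, by omega, ?_⟩
        rw [hi, h3, h4, hfg' j (by omega), ← hfg' (j + 1) (by omega)]
        simp

lemma holeDist_le {u : V} {c : G.Walk u u} {n : ℤ} {f : ℤ → V} (hf : HoleFn G n f)
    (he : ∀ e, e ∈ c.edges ↔ ∃ i, e = s(f i, f (i + 1))) {x y : ℤ} (hxy : x ≤ y) :
    (holeDist G c (f x) (f y) : ℤ) ≤ y - x := by
  have hn := hf.1
  have key : ∀ k : ℕ, ∃ W : (holeGraph G c).Walk (f x) (f (x + k)), W.length = k := by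
    intro k
    induction k with
    | zero => exact ⟨Walk.nil.copy rfl (by simp), by simp⟩
    | succ k ih =>
      obtain ⟨W, hW⟩ := ih
      have hadj : (holeGraph G c).Adj (f (x + k)) (f (x + (k + 1 : ℕ))) := by
        rw [holeGraph, fromEdgeSet_adj]
        refine ⟨(he _).2 ⟨x + k, by push_cast; rw [add_assoc]⟩,
          (hf.2.2 _ _ (by push_cast; omega) (by push_cast; omega)).1⟩
      exact ⟨W.concat hadj, by rw [Walk.length_concat, hW]⟩
  obtain ⟨W, hW⟩ := key (y - x).toNat
  have h1 := dist_le W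
  rw [hW, show x + ((y - x).toNat : ℤ) = y by omega] at h1
  rw [holeDist]; omega

lemma nonMajor_of_not_cMajor {u : V} {c : G.Walk u u} {n : ℤ} {f : ℤ → V} (hf : HoleFn G n f)
    (hs : ∀ z, z ∈ c.support ↔ ∃ i, z = f i)
    (he : ∀ e, e ∈ c.edges ↔ ∃ i, e = s(f i, f (i + 1))) {z : V} (hz : ¬ CMajor G c z) :
    NonMajor G f z := by
  rw [CMajor, not_and_or, not_not, not_not] at hz
  rcases hz with hz | ⟨w, hw, h⟩
  · exact Or.inl ((hs z).1 hz)
  · obtain ⟨r, rfl⟩ := (hs w).1 hw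
    refine Or.inr ⟨r, fun i hi => ?_⟩
    rcases h _ ((hs _).2 ⟨i, rfl⟩) hi with h1 | h1
    · exact Or.inl h1
    · right
      obtain ⟨j, hj⟩ := (he _).1 h1
      have hadj : G.Adj (f r) (f i) := by
        have : G.Adj (f j) (f (j + 1)) :=
          ((hf.2.2 j (j + 1) (by omega) (by have := hf.1; omega)).2).2 (Or.inl rfl)
        rwa [← mem_edgeSet, hj, mem_edgeSet]
      obtain ⟨k, h2, h3, h4⟩ := hf.exists_window i r
      rw [h4] at hadj ⊢
      have hk : r ≠ k := by rintro rfl; exact hadj.ne rfl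
      rcases ((hf.2.2 r k (by omega) (by omega)).2).1 hadj with rfl | rfl
      · exact Or.inl rfl
      · right; exact hf.eq_of_eq_add (by ring)

lemma nonMajor_of_window {n : ℤ} {f : ℤ → V} (hf : HoleFn G n f) {z : V} (a r : ℤ)
    (h : ∀ j, a ≤ j → j < a + n → G.Adj z (f j) → r - 1 ≤ j ∧ j ≤ r + 1) : NonMajor G f z := by
  refine Or.inr ⟨r, fun i hi => ?_⟩
  obtain ⟨j, h1, h2, h3⟩ := hf.exists_window i a
  rw [h3] at hi ⊢
  obtain ⟨h4, h5⟩ := h j h1 h2 hi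
  obtain rfl | rfl | rfl : j = r ∨ j = r + 1 ∨ j = r - 1 := by omega
  · exact Or.inl rfl
  · exact Or.inr (Or.inl rfl)
  · exact Or.inr (Or.inr rfl)

/-- The neighbours on a hole of a vertex that is not major, as a span of length at most two. -/
lemma NonMajor.exists_span {n : ℤ} {f : ℤ → V} (hf : HoleFn G n f) {z : V}
    (hz : NonMajor G f z) (hzf : ∀ i, z ≠ f i) {x : ℤ} (hx : G.Adj z (f x)) :
    ∃ α γ, α ≤ x ∧ x ≤ γ ∧ γ ≤ α + 2 ∧ G.Adj z (f α) ∧ G.Adj z (f γ) ∧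
      ∀ j, γ < j → j < α + n → ¬ G.Adj z (f j) := by
  have hn := hf.1
  rcases hz with ⟨i, hi⟩ | ⟨r, hr⟩
  · exact absurd hi (hzf i)
  obtain ⟨r, hxr, hxr', hr⟩ : ∃ r, r - 1 ≤ x ∧ x ≤ r + 1 ∧
      ∀ i, r - 2 < i → i < r - 1 + n → G.Adj z (f i) → i = r ∨ i = r + 1 ∨ i = r - 1 := by
    obtain ⟨r', h1, h2, h3⟩ := hf.exists_window r (x - 1)
    have h4 : f (r + 1) = f (r' + 1) ∧ f (r - 1) = f (r' - 1) := by
      exact ⟨hf.add_congr h3 1, hf.add_congr h3 (-1)⟩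
    have hr' : ∀ r'', f r'' = f r' → f (r'' + 1) = f (r' + 1) → f (r'' - 1) = f (r' - 1) →
        ∀ i, r'' - 2 < i → i < r'' - 1 + n → G.Adj z (f i) →
          i = r'' ∨ i = r'' + 1 ∨ i = r'' - 1 := by
      intro r'' e1 e2 e3 i e4 e5 hi
      have h5 := hr i hi
      rw [h3, h4.1, h4.2, ← e1, ← e2, ← e3] at h5
      by_contra hcon
      rcases h5 with h5 | h5 | h5
      · rcases lt_or_gt_of_ne (show i ≠ r'' by omega) with h | h
        · exact (hf.2.2 i r'' h (by omega)).1 h5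
        · exact (hf.2.2 r'' i h (by omega)).1 h5.symm
      · rcases lt_or_gt_of_ne (show i ≠ r'' + 1 by omega) with h | h
        · exact (hf.2.2 i (r'' + 1) h (by omega)).1 h5
        · exact (hf.2.2 (r'' + 1) i h (by omega)).1 h5.symm
      · exact (hf.2.2 (r'' - 1) i (by omega) (by omega)).1 h5.symm
    have h6 := hr' r' rfl rfl rfl
    rcases eq_or_ne r' (x - 1 + n) with h7 | h7
    · omega
    · rcases lt_or_ge r' (x + 2) with h8 | h8
      · exact ⟨r', by omega, by omega, h6⟩
      · exfalso
        rcases eq_or_ne r' (x + n - 1) with h9 | h9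
        · omega
        · have := h6 (x + n) (by omega) (by omega) (by rw [hf.2.1]; exact hx)
          omega
  by_cases hA : G.Adj z (f (r - 1))
  · by_cases hC : G.Adj z (f (r + 1))
    · refine ⟨r - 1, r + 1, hxr, hxr', by omega, hA, hC, fun j h1 h2 h3 => ?_⟩
      have := hr j (by omega) (by omega) h3
      omega
    · by_cases hB : G.Adj z (f r)
      · have : x ≠ r + 1 := by rintro rfl; exact hC hx
        refine ⟨r - 1, r, hxr, by omega, by omega, hA, hB, fun j h1 h2 h3 => ?_⟩
        have := hr j (by omega) (by omega) h3
        obtain rfl : j = r + 1 := by omega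
        exact hC h3
      · have : x ≠ r + 1 := by rintro rfl; exact hC hx
        have : x ≠ r := by rintro rfl; exact hB hx
        refine ⟨r - 1, r - 1, hxr, by omega, by omega, hA, hA, fun j h1 h2 h3 => ?_⟩
        have := hr j (by omega) (by omega) h3
        obtain rfl | rfl : j = r + 1 ∨ j = r := by omega
        · exact hC h3
        · exact hB h3
  · have hA' : ¬ G.Adj z (f (r - 1 + n)) := by rwa [hf.2.1]
    have hxA : x ≠ r - 1 := by rintro rfl; exact hA hx
    by_cases hB : G.Adj z (f r)
    · by_cases hC : G.Adj z (f (r + 1))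
      · refine ⟨r, r + 1, by omega, by omega, by omega, hB, hC, fun j h1 h2 h3 => ?_⟩
        rcases eq_or_ne j (r - 1 + n) with rfl | h4
        · exact hA' h3
        · have := hr j (by omega) (by omega) h3
          omega
      · have : x ≠ r + 1 := by rintro rfl; exact hC hx
        refine ⟨r, r, by omega, by omega, by omega, hB, hB, fun j h1 h2 h3 => ?_⟩
        rcases eq_or_ne j (r - 1 + n) with rfl | h4
        · exact hA' h3
        · have := hr j (by omega) (by omega) h3
          obtain rfl : j = r + 1 := by omega
          exact hC h3
    · have : x ≠ r := by rintro rfl; exact hB hx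
      have hB' : ¬ G.Adj z (f (r + n)) := by rwa [hf.2.1]
      obtain rfl : x = r + 1 := by omega
      refine ⟨r + 1, r + 1, by omega, by omega, by omega, hx, hx, fun j h1 h2 h3 => ?_⟩
      rcases eq_or_ne j (r - 1 + n) with rfl | h4
      · exact hA' h3
      rcases eq_or_ne j (r + n) with rfl | h4
      · exact hB' h3
      have := hr j (by omega) (by omega) h3
      omega

/-- `G` is a candidate with no long even hole shorter than `n`, where `n` is even and large. -/
structure Extremal (G : SimpleGraph V) (ℓ : ℕ) (n : ℤ) : Prop where
  candidate : Candidate G ℓ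
  six_le : 6 ≤ ℓ
  even : Even n
  large : 2 * (ℓ : ℤ) + 2 ≤ n
  minimal : ∀ n' f, HoleFn G n' f → (ℓ : ℤ) ≤ n' → Even n' → n ≤ n'

/-- Replacing the arc `f 0, …, f t` by the path `q` yields another hole. -/
lemma Detour.replace {n t m : ℤ} {f q : ℤ → V} (h : Detour G n f t q m) (h4 : 4 ≤ n - t + m) :
    ∃ f', HoleFn G (n - t + m) f' ∧ (∀ i, 0 ≤ i → i ≤ m → f' i = q i) ∧
      ∀ i, m ≤ i → i ≤ n - t + m → f' i = f (i - m + t) := by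
  obtain ⟨hole, path, hs, he, h1, h2, h3, anti⟩ := h
  obtain ⟨f', hf', hg⟩ := holeFn_of_window (G := G) (n := n - t + m)
    (g := fun i => if i ≤ m then q i else f (i - m + t)) h4 (by
      intro i j hi hij hj
      by_cases hjm : j ≤ m
      · have := path i j hi hij hjm
        simp only [if_pos hjm, if_pos (show i ≤ m by omega)]
        exact ⟨this.1, this.2.trans ⟨fun _ => by omega, fun _ => by omega⟩⟩
      · by_cases him : i ≤ m
        · simp only [if_neg hjm, if_pos him]
          rcases eq_or_ne i 0 with rfl | hi0
          · have := hole.2.2 0 (j - m + t) (by omega) (by omega)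
            rw [hs]
            exact ⟨this.1, this.2.trans ⟨fun _ => by omega, fun _ => by omega⟩⟩
          rcases eq_or_ne i m with rfl | him'
          · have := hole.2.2 t (j - i + t) (by omega) (by omega)
            rw [he]
            exact ⟨this.1, this.2.trans ⟨fun _ => by omega, fun _ => by omega⟩⟩
          have := anti i (j - m + t) (by omega) (by omega) (by omega) (by omega)
          exact ⟨this.1, ⟨fun h => absurd h this.2, fun _ => by omega⟩⟩
        · have := hole.2.2 (i - m + t) (j - m + t) (by omega) (by omega)
          simp only [if_neg hjm, if_neg him]
          exact ⟨this.1, this.2.trans ⟨fun _ => by omega, fun _ => by omega⟩⟩)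
  have hend : f' (n - t + m) = f n := by
    have e1 := hf'.2.1 0
    have e2 := hole.2.1 0
    rw [zero_add] at e1 e2
    rw [e1, e2, hg 0 le_rfl (by omega)]
    simp only [if_pos (show (0 : ℤ) ≤ m by omega), hs]
  refine ⟨f', hf', fun i hi him => ?_, fun i hmi hi => ?_⟩
  · rw [hg i hi (by omega)]; simp only [if_pos him]
  · rcases eq_or_ne i (n - t + m) with rfl | hne
    · rw [hend]; congr 1; ring
    · rw [hg i (by omega) (by omega)]
      rcases eq_or_ne i m with rfl | hne'
      · simp [he]
      · simp only [if_neg (show ¬ i ≤ m by omega)]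

lemma Detour.start_ne_end {n t m : ℤ} {f q : ℤ → V} (h : Detour G n f t q m) :
    f 0 ≠ f t ∧ ¬ G.Adj (f 0) (f t) := by
  have := h.two_le
  have := h.le_sub
  obtain ⟨h1, h2⟩ := h.hole.2.2 0 t (by omega) (by omega)
  exact ⟨h1, fun h => by have := h2.1 h; omega⟩

/-- The long way round the hole, from the start of a detour to its end. -/
lemma Detour.exists_far_walk {n t m : ℤ} {f q : ℤ → V} (h : Detour G n f t q m) :
    ∃ P : G.Walk (f 0) (f t), IsInducedPath P ∧ (P.length : ℤ) = n - t ∧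
      ∀ z, z ∈ inter P ↔ ∃ i, t < i ∧ i < n ∧ z = f i := by
  have h2 := h.two_le
  have h3 := h.le_sub
  obtain ⟨P, hP, hl, -, hi⟩ := ((h.hole.arc (x := t) (y := n) (by omega)).reflect n).exists_walk
    (a := f 0) (b := f t) (by omega)
    (by simpa using h.hole.2.1 0) (by simp)
  refine ⟨P, hP, by omega, fun z => (hi z).trans ?_⟩
  constructor
  · rintro ⟨i, h4, h5, rfl⟩; exact ⟨n - i, by omega, by omega, rfl⟩
  · rintro ⟨i, h4, h5, rfl⟩; exact ⟨n - i, by omega, by omega, by simp⟩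

lemma HoleFn.arc_anti {n t : ℤ} {f : ℤ → V} (hf : HoleFn G n f) {i j : ℤ} (hi : 0 < i)
    (hit : i < t) (hj : t < j) (hjn : j < n) : f i ≠ f j ∧ ¬ G.Adj (f i) (f j) := by
  obtain ⟨h1, h2⟩ := hf.2.2 i j (by omega) (by omega)
  exact ⟨h1, fun h => by have := h2.1 h; omega⟩

lemma Detour.jewel {n t m : ℤ} {f q : ℤ → V} (h : Detour G n f t q m) {ℓ : ℕ}
    (hG : Candidate G ℓ) (hpar : ¬ (Even m ↔ Even t)) (hm : m ≤ ℓ) (ht : t ≤ ℓ)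
    (hl : ℓ ≤ n - t + m) (hl' : ℓ ≤ n) : False := by
  have h1 := h.one_le
  have h2 := h.two_le
  have h3 := h.le_sub
  obtain ⟨Q₁, hQ₁, l₁, -, i₁⟩ := h.path.exists_walk (by omega) h.start_eq h.end_eq
  obtain ⟨Q₂, hQ₂, l₂, -, i₂⟩ := (h.hole.arc (x := 0) (y := t) (by omega)).exists_walk (by omega)
    rfl rfl
  obtain ⟨P, hP, l₃, i₃⟩ := h.exists_far_walk
  refine hG.1.2.1 ⟨_, ?_, f 0, f t, Q₁, Q₂, P, h.start_ne_end.1, hQ₁, hQ₂, hP, ?_, rfl, ?_, ?_⟩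
  · rw [Walk.length_support, Walk.length_support]; omega
  · rw [← Int.even_coe_nat, ← Int.even_coe_nat, l₁, l₂]; simpa using hpar
  · omega
  · intro x hx y hy
    obtain ⟨j, h4, h5, rfl⟩ := (i₃ _).1 hx
    rw [ne_comm, G.adj_comm]
    rcases hy with hy | hy
    · obtain ⟨i, h6, h7, rfl⟩ := (i₁ _).1 hy
      exact h.anti i j h6 h7 h4 h5
    · obtain ⟨i, h6, h7, rfl⟩ := (i₂ _).1 hy
      exact h.hole.arc_anti h6 h7 h4 h5

lemma Detour.theta {n t m : ℤ} {f q : ℤ → V} (h : Detour G n f t q m) {ℓ : ℕ}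
    (hG : Candidate G ℓ)
    (hanti : ∀ i j, 0 < i → i < m → 0 < j → j < t → q i ≠ f j ∧ ¬ G.Adj (q i) (f j))
    (hl₁ : ℓ ≤ n) (hl₂ : ℓ ≤ t + m) (hl₃ : ℓ ≤ n - t + m) : False := by
  have h1 := h.one_le
  have h2 := h.two_le
  have h3 := h.le_sub
  obtain ⟨Q₁, hQ₁, l₁, -, i₁⟩ := h.path.exists_walk (by omega) h.start_eq h.end_eq
  obtain ⟨Q₂, hQ₂, l₂, -, i₂⟩ := (h.hole.arc (x := 0) (y := t) (by omega)).exists_walk (by omega)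
    rfl rfl
  obtain ⟨P, hP, l₃, i₃⟩ := h.exists_far_walk
  refine hG.1.2.2.1 ⟨f 0, f t, Q₁, Q₂, P, h.start_ne_end.1, h.start_ne_end.2, hQ₁, hQ₂, hP,
    ?_, ?_, ?_, by omega, by omega, by omega⟩
  · intro x hx y hy
    obtain ⟨i, h4, h5, rfl⟩ := (i₁ _).1 hx
    obtain ⟨j, h6, h7, rfl⟩ := (i₂ _).1 hy
    exact hanti i j h4 h5 h6 h7
  · intro x hx y hy
    obtain ⟨i, h4, h5, rfl⟩ := (i₁ _).1 hx
    obtain ⟨j, h6, h7, rfl⟩ := (i₃ _).1 hy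
    exact h.anti i j h4 h5 h6 h7
  · intro x hx y hy
    obtain ⟨i, h4, h5, rfl⟩ := (i₂ _).1 hx
    obtain ⟨j, h6, h7, rfl⟩ := (i₃ _).1 hy
    exact h.hole.arc_anti h4 h5 h6 h7

/-- A detour that shortens a minimal hole has the wrong parity and replaces a long arc. -/
lemma Detour.short {n t m : ℤ} {f q : ℤ → V} (h : Detour G n f t q m) {ℓ : ℕ}
    (hE : Extremal G ℓ n) (hmt : m < t) (hl : ℓ ≤ n - t + m) :
    ¬ (Even m ↔ Even t) ∧ (ℓ : ℤ) < t := by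
  have h1 := h.one_le
  have h6 := hE.six_le
  have hn := hE.large
  have hpar : ¬ (Even m ↔ Even t) := by
    intro hp
    obtain ⟨f', hf', -, -⟩ := h.replace (by omega)
    have hev : Even (n - t + m) := by
      rw [Int.even_add, Int.even_sub]
      simp [hE.even, hp]
    have := hE.minimal _ f' hf' hl hev
    omega
  refine ⟨hpar, ?_⟩
  by_contra hcon
  exact h.jewel hE.candidate hpar (by omega) (by omega) hl (by omega)

lemma IndPath.cons {k : ℤ} {q : ℤ → V} {a : V} (h : IndPath G 1 k q)
    (ha : ∀ i, 1 ≤ i → i ≤ k → a ≠ q i ∧ (G.Adj a (q i) ↔ i = 1)) :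
    ∃ E, IndPath G 0 k E ∧ E 0 = a ∧ ∀ i, 1 ≤ i → E i = q i := by
  refine ⟨fun i => if i < 1 then a else q i, fun i j h1 h2 h3 => ?_, by simp, fun i hi => ?_⟩
  · simp only [if_neg (show ¬ j < 1 by omega)]
    by_cases hi : i < 1
    · have := ha j (by omega) h3
      simp only [if_pos hi]
      exact ⟨this.1, this.2.trans ⟨fun _ => by omega, fun _ => by omega⟩⟩
    · simp only [if_neg hi]
      exact h i j (by omega) h2 h3
  · simp only [if_neg (show ¬ i < 1 by omega)]

lemma IndPath.concat {x k : ℤ} {q : ℤ → V} {b : V} (h : IndPath G x k q)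
    (hb : ∀ i, x ≤ i → i ≤ k → q i ≠ b ∧ (G.Adj (q i) b ↔ i = k)) :
    ∃ E, IndPath G x (k + 1) E ∧ E (k + 1) = b ∧ ∀ i, i ≤ k → E i = q i := by
  refine ⟨fun i => if i ≤ k then q i else b, fun i j h1 h2 h3 => ?_, by simp, fun i hi => ?_⟩
  · simp only [if_pos (show i ≤ k by omega)]
    by_cases hj : j ≤ k
    · simp only [if_pos hj]
      exact h i j (by omega) h2 hj
    · have := hb i (by omega) (by omega)
      simp only [if_neg hj]
      exact ⟨this.1, this.2.trans ⟨fun _ => by omega, fun _ => by omega⟩⟩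
  · simp only [if_pos hi]

/-- Replacing `f r` by a vertex `z` with the same neighbours on the hole, up to `f r`. -/
lemma HoleFn.twin {n : ℤ} {f : ℤ → V} (hf : HoleFn G n f) {z : V} {r : ℤ}
    (hz : ∀ j, z ≠ f j) (h₁ : G.Adj z (f (r - 1))) (h₂ : G.Adj z (f (r + 1)))
    (h₃ : ∀ j, r + 1 < j → j < r - 1 + n → ¬ G.Adj z (f j)) :
    ∃ f', HoleFn G n f' ∧ f' r = z ∧ ∀ i, r < i → i < r + n → f' i = f i := by
  have hn := hf.1
  have hD : Detour G n (fun i => f (i + (r - 1))) 2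
      (fun i => if i < 1 then f (r - 1) else if 1 < i then f (r + 1) else z) 2 := by
    refine ⟨hf.shift _, ?_, by simp, ?_, by omega, le_rfl, by omega, ?_⟩
    · intro i j h4 h5 h6
      obtain ⟨rfl, rfl⟩ | ⟨rfl, rfl⟩ | ⟨rfl, rfl⟩ :
        (i = 0 ∧ j = 1) ∨ (i = 0 ∧ j = 2) ∨ (i = 1 ∧ j = 2) := by omega
      · simpa using ⟨(hz _).symm, h₁.symm⟩
      · have := hf.2.2 (r - 1) (r + 1) (by omega) (by omega)
        simp only [zero_lt_one, if_true, show ¬ (2 : ℤ) < 1 by omega, if_false,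
          show (1 : ℤ) < 2 by omega]
        exact ⟨this.1, this.2.trans ⟨fun _ => by omega, fun _ => by omega⟩⟩
      · simpa using ⟨hz _, h₂⟩
    · simp only [show ¬ (2 : ℤ) < 1 by omega, if_false, show (1 : ℤ) < 2 by omega, if_true]
      congr 1; ring
    · intro i j h4 h5 h6 h7
      obtain rfl : i = 1 := by omega
      simp only [lt_irrefl, if_false]
      exact ⟨hz _, h₃ _ (by omega) (by omega)⟩
  obtain ⟨f', hf', e₁, e₂⟩ := hD.replace (by omega)
  rw [show n - 2 + 2 = n by ring] at hf'
  refine ⟨fun i => f' (i + (1 - r)), hf'.shift _, ?_, fun i h4 h5 => ?_⟩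
  · have := e₁ 1 (by omega) (by omega)
    simpa using this
  · have := e₂ (i + (1 - r)) (by omega) (by omega)
    simp only [this]; congr 1; ring

/-- An induced path `q 1, …, q k` off the hole `f`, only whose ends have neighbours on the hole:
those of `q 1` lie between `f 0` and `f s`, those of `q k` between `f t` and `f (t + s')`. -/
structure Attached (G : SimpleGraph V) (n : ℤ) (f : ℤ → V) (k : ℤ) (q : ℤ → V) (s t s' : ℤ) :
    Prop where
  hole : HoleFn G n f
  path : IndPath G 1 k q
  off : ∀ i j, 1 ≤ i → i ≤ k → q i ≠ f j
  mid : ∀ i j, 1 < i → i < k → ¬ G.Adj (q i) (f j)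
  two_le : 2 ≤ k
  s_nonneg : 0 ≤ s
  s_le : s ≤ 2
  s'_nonneg : 0 ≤ s'
  s'_le : s' ≤ 2
  t_pos : 0 < t
  s_lt : s < t + s'
  lt_n : t + s' < n
  start_zero : G.Adj (q 1) (f 0)
  start_s : G.Adj (q 1) (f s)
  start_far : ∀ j, s < j → j < n → ¬ G.Adj (q 1) (f j)
  end_t : G.Adj (q k) (f t)
  end_s : G.Adj (q k) (f (t + s'))
  end_far : ∀ j, t + s' < j → j < t + n → ¬ G.Adj (q k) (f j)

namespace Attached

variable {n k s t s' : ℤ} {f q : ℤ → V}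

lemma reverse (h : Attached G n f k q s t s') :
    Attached G n (fun i => f (t + s' - i)) k (fun i => q (k + 1 - i)) s' (t + s' - s) s := by
  have h1 := h.s_nonneg
  have h2 := h.s'_nonneg
  have h3 := h.t_pos
  have h4 := h.s_lt
  have h5 := h.lt_n
  refine ⟨h.hole.reflect _, ?_, ?_, ?_, h.two_le, h.s'_nonneg, h.s'_le, h.s_nonneg, h.s_le,
    by omega, by omega, by omega, ?_, ?_, ?_, ?_, ?_, ?_⟩
  · have := h.path.reflect (k + 1)
    simpa using this
  · intro i j hi hj; exact h.off _ _ (by omega) (by omega)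
  · intro i j hi hj; exact h.mid _ _ (by omega) (by omega)
  · simpa using h.end_s
  · simpa using h.end_t
  · intro j hj hjn
    simp only [add_sub_cancel_right]
    have := h.end_far (t + s' - j + n) (by omega) (by omega)
    rwa [h.hole.2.1] at this
  · simpa using h.start_s
  · simpa using h.start_zero
  · intro j hj hjn
    simp only [add_sub_cancel_left]
    have := h.start_far (t + s' - j + n) (by omega) (by omega)
    rwa [h.hole.2.1] at this

lemma mirror (h : Attached G n f k q s t s') (hst : s < t) :
    Attached G n (fun i => f (s - i)) k q s (n + s - t - s') s' := by
  have h1 := h.s_nonneg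
  have h2 := h.s'_nonneg
  have h5 := h.lt_n
  refine ⟨h.hole.reflect _, h.path, fun i j hi hj => h.off _ _ hi hj,
    fun i j hi hj => h.mid _ _ hi hj, h.two_le, h1, h.s_le, h2, h.s'_le, by omega, by omega,
    by omega, ?_, ?_, ?_, ?_, ?_, ?_⟩
  · simpa using h.start_s
  · simpa using h.start_zero
  · intro j hj hjn
    have := h.start_far (s - j + n) (by omega) (by omega)
    rwa [h.hole.2.1] at this
  · have := h.end_s
    rwa [← h.hole.sub_period, show t + s' - n = s - (n + s - t - s') by ring] at this
  · have := h.end_t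
    rwa [← h.hole.sub_period, show t - n = s - (n + s - t - s' + s') by ring] at this
  · intro j hj hjn
    have := h.end_far (s - j + n + n) (by omega) (by omega)
    rwa [h.hole.2.1, h.hole.2.1] at this

lemma far_start (h : Attached G n f k q s t s') {i j : ℤ} (hi : 1 ≤ i) (hik : i < k)
    (hj : s < j) (hjn : j < n) : ¬ G.Adj (q i) (f j) := by
  rcases hi.eq_or_lt with rfl | hi
  · exact h.start_far j hj hjn
  · exact h.mid i j hi hik

lemma far_end (h : Attached G n f k q s t s') {i j : ℤ} (hi : 1 < i) (hik : i ≤ k)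
    (hj : t + s' < j) (hjn : j < t + n) : ¬ G.Adj (q i) (f j) := by
  rcases hik.eq_or_lt with rfl | hik
  · exact h.end_far j hj hjn
  · exact h.mid i j hi hik

lemma detour (h : Attached G n f k q s t s') (h2 : 2 ≤ t + s') (hn : t + s' ≤ n - 2) :
    ∃ E, Detour G n f (t + s') E (k + 1) ∧ ∀ i, 1 ≤ i → i ≤ k → E i = q i := by
  have hk := h.two_le
  have h3 := h.t_pos
  have hs := h.s_lt
  have hlt := h.lt_n
  have hf0 : ∀ i, 1 ≤ i → i ≤ k → f 0 ≠ q i ∧ (G.Adj (f 0) (q i) ↔ i = 1) := by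
    refine fun i hi hik => ⟨(h.off i 0 hi hik).symm, fun hadj => ?_, ?_⟩
    · by_contra hne
      rw [← h.hole.2.1, zero_add] at hadj
      exact h.far_end (by omega) hik (by omega) (by omega) hadj.symm
    · rintro rfl; exact h.start_zero.symm
  obtain ⟨E₁, hE₁, e₁, e₂⟩ := h.path.cons hf0
  obtain ⟨E, hE, e₃, e₄⟩ := hE₁.concat (b := f (t + s')) (by
    intro i hi hik
    rcases hi.eq_or_lt with rfl | hi
    · have := h.hole.2.2 0 (t + s') (by omega) (by omega)
      rw [e₁]
      exact ⟨this.1, this.2.trans ⟨fun _ => by omega, fun _ => by omega⟩⟩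
    · rw [e₂ i (by omega)]
      refine ⟨h.off _ _ (by omega) hik, fun hadj => ?_, ?_⟩
      · by_contra hne
        exact h.far_start (by omega) (by omega) hs hlt hadj
      · rintro rfl; exact h.end_s)
  refine ⟨E, ⟨h.hole, hE, ?_, e₃, by omega, h2, hn, ?_⟩, fun i h1 h2 => ?_⟩
  · rw [e₄ 0 (by omega), e₁]
  · intro i j h4 h5 h6 h7
    rw [e₄ i (by omega), e₂ i (by omega)]
    refine ⟨h.off _ _ (by omega) (by omega), ?_⟩
    rcases eq_or_ne i 1 with rfl | hi
    · exact h.far_start le_rfl (by omega) (by omega) h7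
    · exact h.far_end (by omega) (by omega) h6 (by omega)
  · rw [e₄ i h2, e₂ i h1]

variable {ℓ : ℕ}

lemma false_of_zero_zero (h : Attached G n f k q 0 t 0) (hG : Candidate G ℓ) (h2 : 2 ≤ t)
    (hn : t ≤ n - 2) (hl₁ : ℓ ≤ n) (hl₂ : ℓ ≤ t + k + 1) (hl₃ : ℓ ≤ n - t + k + 1) : False := by
  obtain ⟨E, hD, hE⟩ := h.detour (by omega) (by omega)
  rw [add_zero] at hD
  refine hD.theta hG (fun i j h1 h3 h4 h5 => ?_) hl₁ (by omega) (by omega)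
  rw [hE i (by omega) (by omega)]
  refine ⟨h.off _ _ (by omega) (by omega), ?_⟩
  have hk := h.two_le
  rcases eq_or_ne i 1 with rfl | hi
  · exact h.far_start le_rfl (by omega) (by omega) (by omega)
  · rw [← h.hole.2.1]
    exact h.far_end (by omega) (by omega) (by omega) (by omega)

lemma false_of_zero_two (h : Attached G n f k q 0 t 2) (hG : Candidate G ℓ)
    (hn : t ≤ n - 3) (hl₁ : ℓ ≤ n) (hl₂ : ℓ ≤ t + k + 1) (hl₃ : ℓ ≤ n - t + k - 1) : False := by
  have hk := h.two_le
  have h3 := h.t_pos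
  obtain ⟨f', hf', e₁, e₂⟩ := h.hole.twin (z := q k) (r := t + 1)
    (fun j => h.off k j (by omega) le_rfl) (by simpa using h.end_t)
    (by rw [add_assoc]; exact h.end_s) (fun j h1 h2 => h.end_far j (by omega) (by omega))
  have e₃ : ∀ j, 0 ≤ j → j < n → j ≠ t + 1 → f' j = f j := by
    intro j h4 h5 h6
    rcases lt_or_gt_of_ne h6 with h7 | h7
    · rw [← hf'.2.1, ← h.hole.2.1, e₂ _ (by omega) (by omega)]
    · exact e₂ j h7 (by omega)
  obtain ⟨E, hE, e₄, e₅⟩ := h.path.cons (a := f 0) (by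
    refine fun i hi hik => ⟨(h.off i 0 hi hik).symm, fun hadj => ?_, ?_⟩
    · by_contra hne
      rw [← h.hole.2.1, zero_add] at hadj
      exact h.far_end (by omega) hik (by omega) (by omega) hadj.symm
    · rintro rfl; exact h.start_zero.symm)
  have key : ∀ i j, 0 < i → i < k → 0 < j → j < n → j ≠ t + 1 →
      E i ≠ f' j ∧ ¬ G.Adj (E i) (f' j) := by
    intro i j h4 h5 h6 h7 h8
    rw [e₅ i (by omega), e₃ j (by omega) h7 h8]
    exact ⟨h.off _ _ (by omega) (by omega), h.far_start (by omega) h5 h6 h7⟩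
  have hD : Detour G n f' (t + 1) E k := by
    refine ⟨hf', hE, ?_, ?_, by omega, by omega, by omega, ?_⟩
    · rw [e₄, e₃ 0 le_rfl (by omega) (by omega)]
    · rw [e₁, e₅ k (by omega)]
    · intro i j h4 h5 h6 h7; exact key i j h4 h5 (by omega) h7 (by omega)
  exact hD.theta hG (fun i j h4 h5 h6 h7 => key i j h4 h5 (by omega) (by omega) (by omega))
    hl₁ (by omega) (by omega)

lemma false_of_two_zero (h : Attached G n f k q 2 t 0) (hG : Candidate G ℓ)
    (hn : t ≤ n - 1) (hl₁ : ℓ ≤ n) (hl₂ : ℓ ≤ t + k - 1) (hl₃ : ℓ ≤ n - t + k + 1) : False :=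
  h.reverse.false_of_zero_two hG (by omega) hl₁ (by omega) (by omega)

lemma false_of_two_two (h : Attached G n f k q 2 t 2) (hk : 3 ≤ k) (hG : Candidate G ℓ)
    (h2 : 3 ≤ t) (hn : t ≤ n - 3) (hl₁ : ℓ ≤ n) (hl₂ : ℓ ≤ t + k - 1)
    (hl₃ : ℓ ≤ n - t + k - 1) : False := by
  obtain ⟨f', hf', e₁, e₂⟩ := h.hole.twin (z := q 1) (r := 1)
    (fun j => h.off 1 j le_rfl (by omega)) (by simpa using h.start_zero)
    (by simpa using h.start_s) (fun j h1 h2 => h.start_far j (by omega) (by omega))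
  have hA : Attached G n (fun i => f' (i + 1)) (k - 1) (fun i => q (i + 1)) 0 (t - 1) 2 := by
    refine ⟨hf'.shift 1, (h.path.shift 1).mono (by omega) le_rfl, ?_, ?_, by omega, le_rfl, by omega,
      by omega, by omega, by omega, by omega, by omega, ?_, ?_, ?_, ?_, ?_, ?_⟩
    · intro i j h4 h5
      obtain ⟨j', h6, h7, h8⟩ := hf'.exists_window (j + 1) 1
      simp only [h8]
      rcases h6.eq_or_lt with rfl | h6
      · rw [e₁]; exact (h.path 1 (i + 1) le_rfl (by omega) (by omega)).1.symm
      · rw [e₂ j' h6 h7]; exact h.off _ _ (by omega) (by omega)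
    · intro i j h4 h5
      obtain ⟨j', h6, h7, h8⟩ := hf'.exists_window (j + 1) 1
      simp only [h8]
      rcases h6.eq_or_lt with rfl | h6
      · rw [e₁, G.adj_comm, (h.path 1 (i + 1) le_rfl (by omega) (by omega)).2]; omega
      · rw [e₂ j' h6 h7]; exact h.mid _ _ (by omega) (by omega)
    · simp only [zero_add, e₁]
      exact (h.path 1 (1 + 1) le_rfl (by omega) (by omega)).2.2 rfl |>.symm
    · simp only [zero_add, e₁]
      exact (h.path 1 (1 + 1) le_rfl (by omega) (by omega)).2.2 rfl |>.symm
    · intro j h4 h5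
      simp only [e₂ (j + 1) (by omega) (by omega)]
      exact h.mid _ _ (by omega) (by omega)
    · simp only [sub_add_cancel, e₂ t (by omega) (by omega)]
      exact h.end_t
    · simp only [sub_add_cancel, show t - 1 + 2 + 1 = t + 2 by ring,
        e₂ (t + 2) (by omega) (by omega)]
      exact h.end_s
    · intro j h4 h5
      simp only [sub_add_cancel]
      rcases lt_trichotomy j n with h6 | rfl | h6
      · rw [e₂ (j + 1) (by omega) (by omega)]
        exact h.end_far _ (by omega) (by omega)
      · rw [add_comm, hf'.2.1, e₁, G.adj_comm, (h.path 1 k le_rfl (by omega) le_rfl).2]; omega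
      · rw [← hf'.sub_period, e₂ (j + 1 - n) (by omega) (by omega), h.hole.sub_period]
        exact h.end_far _ (by omega) (by omega)
  exact hA.false_of_zero_two hG (by omega) hl₁ (by omega) (by omega)

end Attached

lemma forall_ne_fin_three {R : Fin 3 → Fin 3 → Prop} (hs : ∀ i j, R i j → R j i)
    (h₁ : R 0 1) (h₂ : R 0 2) (h₃ : R 1 2) : ∀ i j, i ≠ j → R i j := by
  intro i j hij
  fin_cases i <;> fin_cases j <;> first
    | exact absurd rfl hij
    | assumption
    | (apply hs; assumption)

namespace Attached

variable {n k s t s' : ℤ} {f q : ℤ → V} {ℓ : ℕ}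

lemma isLongHoleOn (h : Attached G n f k q s t s') (h2 : 2 ≤ t + s') (hn : t + s' ≤ n - 2)
    (hl : ℓ ≤ n - (t + s') + (k + 1)) :
    IsLongHoleOn G ℓ ({z | ∃ i, 1 ≤ i ∧ i ≤ k ∧ z = q i} ∪
      {z | ∃ i, t + s' ≤ i ∧ i ≤ n ∧ z = f i}) := by
  have hk := h.two_le
  obtain ⟨E, hD, hE⟩ := h.detour h2 hn
  obtain ⟨F, hF, e₁, e₂⟩ := hD.replace (by omega)
  obtain ⟨c, hc, hlen, hs⟩ := hF.exists_walk
  refine ⟨_, c, hc, by omega, Set.ext fun z => (hs z).trans ⟨?_, ?_⟩⟩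
  · rintro ⟨i, rfl⟩
    obtain ⟨j, h3, h4, h5⟩ := hF.exists_window i 1
    rw [h5]
    rcases le_or_gt j k with h6 | h6
    · exact Or.inl ⟨j, h3, h6, by rw [e₁ j (by omega) (by omega), hE j h3 h6]⟩
    · exact Or.inr ⟨_, by omega, by omega, e₂ j (by omega) (by omega)⟩
  · rintro (⟨i, h3, h4, rfl⟩ | ⟨i, h3, h4, rfl⟩)
    · exact ⟨i, by rw [e₁ i (by omega) (by omega), hE i h3 h4]⟩
    · refine ⟨i - (t + s') + (k + 1), ?_⟩
      rw [e₂ _ (by omega) (by omega)]; congr 1; ring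

lemma false_of_one_one (h : Attached G n f k q 1 t 1) (hG : Candidate G ℓ) (ht : 3 ≤ t)
    (hn : t ≤ n - 3) (hl₁ : ℓ ≤ n) (hl₂ : ℓ ≤ t + k) (hl₃ : ℓ ≤ n - t + k) : False := by
  have hk := h.two_le
  obtain ⟨P₀, hP₀, -, s₀, -⟩ := h.path.exists_walk (by omega) rfl rfl
  obtain ⟨P₁, hP₁, -, s₁, -⟩ := ((h.hole.arc (x := t + 1) (y := n) (by omega)).reflect
    n).exists_walk (a := f 0) (b := f (t + 1)) (by omega) (by simpa using h.hole.2.1 0) (by simp)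
  obtain ⟨P₂, hP₂, -, s₂, -⟩ := (h.hole.arc (x := 1) (y := t) (by omega)).exists_walk (by omega)
    rfl rfl
  replace s₁ : ∀ z, z ∈ P₁.support ↔ ∃ i, t + 1 ≤ i ∧ i ≤ n ∧ z = f i := by
    refine fun z => (s₁ z).trans ⟨?_, ?_⟩
    · rintro ⟨i, h4, h5, rfl⟩; exact ⟨n - i, by omega, by omega, rfl⟩
    · rintro ⟨i, h4, h5, rfl⟩; exact ⟨n - i, by omega, by omega, by simp⟩
  have hadj : ∀ i, G.Adj (f i) (f (i + 1)) := fun i =>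
    (h.hole.2.2 i (i + 1) (by omega) (by omega)).2.2 (Or.inl rfl)
  have hd₁ : ∀ x, x ∈ P₀.support → x ∉ P₁.support := by
    intro x hx hx'
    obtain ⟨i, h4, h5, rfl⟩ := (s₀ x).1 hx
    obtain ⟨j, -, -, h6⟩ := (s₁ _).1 hx'
    exact h.off _ _ h4 h5 h6
  have hd₂ : ∀ x, x ∈ P₀.support → x ∉ P₂.support := by
    intro x hx hx'
    obtain ⟨i, h4, h5, rfl⟩ := (s₀ x).1 hx
    obtain ⟨j, -, -, h6⟩ := (s₂ _).1 hx'
    exact h.off _ _ h4 h5 h6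
  have hd₃ : ∀ x, x ∈ P₁.support → x ∉ P₂.support := by
    intro x hx hx'
    obtain ⟨i, h4, h5, rfl⟩ := (s₁ x).1 hx
    obtain ⟨j, h6, h7, h8⟩ := (s₂ _).1 hx'
    exact (h.hole.2.2 j i (by omega) (by omega)).1 h8.symm
  have hS₀ : vset P₀ = {z | ∃ i, 1 ≤ i ∧ i ≤ k ∧ z = q i} := Set.ext s₀
  have hS₁ : vset P₁ = {z | ∃ i, t + 1 ≤ i ∧ i ≤ n ∧ z = f i} := Set.ext s₁
  have hS₂ : vset P₂ = {z | ∃ i, 1 ≤ i ∧ i ≤ t ∧ z = f i} := Set.ext s₂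
  have hL₁ : IsLongHoleOn G ℓ (vset P₀ ∪ vset P₁) := by
    rw [hS₀, hS₁]
    exact h.isLongHoleOn (by omega) (by omega) (by omega)
  have hL₂ : IsLongHoleOn G ℓ (vset P₀ ∪ vset P₂) := by
    have := (h.mirror (by omega)).isLongHoleOn (ℓ := ℓ) (by omega) (by omega) (by omega)
    rw [hS₀, hS₂]
    convert this using 3
    ext z
    constructor
    · rintro ⟨i, h4, h5, rfl⟩
      refine ⟨n + 1 - i, by omega, by omega, ?_⟩
      rw [← h.hole.sub_period]; congr 1; ring
    · rintro ⟨i, h4, h5, rfl⟩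
      refine ⟨n + 1 - i, by omega, by omega, ?_⟩
      rw [← h.hole.sub_period (n + 1 - i)]; congr 1; ring
  have hL₃ : IsLongHoleOn G ℓ (vset P₁ ∪ vset P₂) := by
    obtain ⟨c, hc, hlen, hs⟩ := h.hole.exists_walk
    refine ⟨_, c, hc, by omega, Set.ext fun z => (hs z).trans ?_⟩
    rw [hS₁, hS₂]
    constructor
    · rintro ⟨i, rfl⟩
      obtain ⟨j, h4, h5, h6⟩ := h.hole.exists_window i 1
      rw [h6]
      rcases le_or_gt j t with h7 | h7
      · exact Or.inr ⟨j, h4, h7, rfl⟩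
      · exact Or.inl ⟨j, by omega, by omega, rfl⟩
    · rintro (⟨i, -, -, rfl⟩ | ⟨i, -, -, rfl⟩) <;> exact ⟨i, rfl⟩
  refine hG.2 ⟨![q 1, f 0, f 1], ![q k, f (t + 1), f t], fun i => match i with
    | 0 => P₀
    | 1 => P₁
    | 2 => P₂, ?_, ?_, ?_, ?_, ?_, ?_⟩
  · exact forall_ne_fin_three (fun _ _ => G.symm.symm _ _) h.start_zero h.start_s (hadj 0)
  · exact forall_ne_fin_three (fun _ _ => G.symm.symm _ _) h.end_s h.end_t (hadj t).symm
  · rintro x ⟨⟨i, rfl⟩, ⟨j, hj⟩⟩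
    exfalso
    have h₁ := (h.path 1 k le_rfl (by omega) le_rfl).1
    have h₂ := (h.hole.2.2 0 (t + 1) (by omega) (by omega)).1
    have h₃ := (h.hole.2.2 0 t (by omega) (by omega)).1
    have h₄ := (h.hole.2.2 1 (t + 1) (by omega) (by omega)).1
    have h₅ := (h.hole.2.2 1 t (by omega) (by omega)).1
    have h₆ := fun j => h.off 1 j le_rfl (by omega)
    have h₇ := fun j => h.off k j (by omega) le_rfl
    fin_cases i <;> fin_cases j
    exacts [h₁ hj.symm, h₆ _ hj.symm, h₆ _ hj.symm, h₇ _ hj, h₂ hj.symm, h₃ hj.symm, h₇ _ hj,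
      h₄ hj.symm, h₅ hj.symm]
  · intro i
    fin_cases i
    exacts [hP₀.1, hP₁.1, hP₂.1]
  · refine forall_ne_fin_three (fun i j hij x h4 h5 => hij x h5 h4) hd₁ hd₂ hd₃
  · refine forall_ne_fin_three (fun i j hij => ?_) hL₁ hL₂ hL₃
    rwa [Set.union_comm]

lemma false_of_two_two_of_eq (h : Attached G n f 2 q 2 t 2) (hG : Candidate G ℓ) (ht : 3 ≤ t)
    (hn : t ≤ n - 3) (hl₁ : ℓ ≤ n) (hl₂ : ℓ ≤ t + 1) (hl₃ : ℓ ≤ n - t + 1) : False := by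
  obtain ⟨f', hf', e₁, e₂⟩ := h.hole.twin (z := q 1) (r := 1)
    (fun j => h.off 1 j le_rfl (by omega)) (by simpa using h.start_zero)
    (by simpa using h.start_s) (fun j h1 h2 => h.start_far j (by omega) (by omega))
  have hx : ∀ i, t ≤ i → i ≤ t + 2 → ¬ G.Adj (q 1) (f i) := fun i h1 h2 =>
    h.start_far i (by omega) (by omega)
  have hadj : ∀ i, G.Adj (f i) (f (i + 1)) := fun i =>
    (h.hole.2.2 i (i + 1) (by omega) (by omega)).2.2 (Or.inl rfl)
  obtain ⟨P₁, hP₁, l₁, s₁, i₁⟩ := (hf'.arc (x := 1) (y := t) (by omega)).exists_walk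
    (b := f t) (by omega) e₁ (e₂ t (by omega) (by omega))
  obtain ⟨P₂, hP₂, l₂, s₂, i₂⟩ := ((hf'.arc (x := t + 2) (y := n + 1) (by omega)).reflect
    (n + 1)).exists_walk (a := q 1) (b := f (t + 2)) (by omega)
      (by simpa [add_comm, e₁] using hf'.2.1 1)
      (by simpa using e₂ (t + 2) (by omega) (by omega))
  have hu : ∀ i, t + 2 < i → i < t + n → ¬ G.Adj (f i) (q 2) :=
    fun i h1 h2 h3 => h.end_far i h1 h2 h3.symm
  refine hG.1.2.2.2 ⟨q 2, f t, f (t + 1), f (t + 2), q 1, P₁, P₂, h.end_t, hadj t, ?_,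
    h.end_s.symm, ?_, h.off _ _ (by omega) le_rfl,
    (h.path 1 2 le_rfl (by omega) le_rfl).2.2 rfl, hx _ (by omega) (by omega),
    hx _ (by omega) (by omega), hx _ (by omega) (by omega), h.off _ _ le_rfl (by omega),
    h.off _ _ le_rfl (by omega), h.off _ _ le_rfl (by omega), hP₁, hP₂, by omega, by omega,
    ?_, ?_, ?_, by omega, by omega, by omega⟩
  · have := hadj (t + 1)
    rwa [add_assoc] at this
  · rw [(h.hole.2.2 t (t + 2) (by omega) (by omega)).2]; omega
  · intro x hx y hy
    obtain ⟨i, h4, h5, rfl⟩ := (i₁ _).1 hx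
    rw [e₂ i h4 (by omega)]
    rcases hy with rfl | rfl
    · refine ⟨(h.off _ _ (by omega) le_rfl).symm, ?_⟩
      rw [← h.hole.2.1]; exact hu _ (by omega) (by omega)
    · obtain ⟨h6, h7⟩ := h.hole.2.2 i (t + 1) (by omega) (by omega)
      exact ⟨h6, fun h8 => by have := h7.1 h8; omega⟩
  · intro x hx y hy
    obtain ⟨i, h4, h5, rfl⟩ := (i₂ _).1 hx
    rw [e₂ (n + 1 - i) (by omega) (by omega)]
    rcases hy with rfl | rfl
    · exact ⟨(h.off _ _ (by omega) le_rfl).symm, hu _ (by omega) (by omega)⟩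
    · obtain ⟨h6, h7⟩ := h.hole.2.2 (t + 1) (n + 1 - i) (by omega) (by omega)
      exact ⟨h6.symm, fun h8 => by have := h7.1 h8.symm; omega⟩
  · rintro x ⟨hx, hx'⟩ y ⟨hy, hy'⟩
    obtain ⟨i, h4, h5, rfl⟩ := (s₁ _).1 hx
    obtain ⟨j, h6, h7, rfl⟩ := (s₂ _).1 hy
    have hi : i ≠ 1 := by rintro rfl; exact hx' e₁
    have hj : j ≠ 0 := by
      rintro rfl
      refine hy' ?_
      change f' (n + 1 - 0) = q 1
      rw [sub_zero, add_comm, hf'.2.1, e₁]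
    obtain ⟨h8, h9⟩ := hf'.2.2 i (n + 1 - j) (by omega) (by omega)
    exact ⟨h8, fun h10 => by have := h9.1 h10; omega⟩

/-- There is no attached path shorter than both of the arcs it could replace. -/
lemma false_of_short (h : Attached G n f k q s t s') (hE : Extremal G ℓ n)
    (h₁ : k + 1 < t + s') (h₂ : k + 1 < n - t + s) (h₃ : 2 * (t + s') ≤ n + 8) : False := by
  have hk := h.two_le
  have h6 := hE.six_le
  have hn := hE.large
  have hs0 := h.s_nonneg
  have hs2 := h.s_le
  have hs0' := h.s'_nonneg
  have hs2' := h.s'_le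
  obtain ⟨E, hD, -⟩ := h.detour (by omega) (by omega)
  obtain ⟨hp, hl⟩ := hD.short hE h₁ (by omega)
  obtain ⟨E', hD', -⟩ := (h.mirror (by omega)).detour (by omega) (by omega)
  obtain ⟨hp', hl'⟩ := hD'.short hE (by omega) (by omega)
  have hss : Even (s + s') := by
    have h7 : n + s - t - s' + s' = n + (s + s') - (t + s') := by ring
    rw [h7, Int.even_sub, Int.even_add (m := n)] at hp'
    have := hE.even
    tauto
  have hG := hE.candidate
  obtain rfl | rfl | rfl : s = 0 ∨ s = 1 ∨ s = 2 := by omega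
  · obtain rfl | rfl | rfl : s' = 0 ∨ s' = 1 ∨ s' = 2 := by omega
    · exact h.false_of_zero_zero hG (by omega) (by omega) (by omega) (by omega) (by omega)
    · simp at hss
    · exact h.false_of_zero_two hG (by omega) (by omega) (by omega) (by omega)
  · obtain rfl | rfl | rfl : s' = 0 ∨ s' = 1 ∨ s' = 2 := by omega
    · simp at hss
    · exact h.false_of_one_one hG (by omega) (by omega) (by omega) (by omega) (by omega)
    · exact absurd hss (by decide)
  · obtain rfl | rfl | rfl : s' = 0 ∨ s' = 1 ∨ s' = 2 := by omega
    · exact h.false_of_two_zero hG (by omega) (by omega) (by omega) (by omega)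
    · exact absurd hss (by decide)
    · rcases hk.eq_or_lt with rfl | hk
      · exact h.false_of_two_two_of_eq hG (by omega) (by omega) (by omega) (by omega) (by omega)
      · exact h.false_of_two_two hk hG (by omega) (by omega) (by omega) (by omega) (by omega)

end Attached

lemma NonMajor.shift {f : ℤ → V} {z : V} (h : NonMajor G f z) (r : ℤ) :
    NonMajor G (fun i => f (i + r)) z := by
  rcases h with ⟨i, hi⟩ | ⟨s, hs⟩
  · exact Or.inl ⟨i - r, by simpa using hi⟩
  · refine Or.inr ⟨s - r, fun i hi => ?_⟩
    have := hs _ hi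
    simpa [show s - r + 1 + r = s + 1 by ring, show s - r - 1 + r = s - 1 by ring] using this

lemma NonMajor.reflect {f : ℤ → V} {z : V} (h : NonMajor G f z) (r : ℤ) :
    NonMajor G (fun i => f (r - i)) z := by
  rcases h with ⟨i, hi⟩ | ⟨s, hs⟩
  · exact Or.inl ⟨r - i, by simpa using hi⟩
  · refine Or.inr ⟨r - s, fun i hi => ?_⟩
    have := hs _ hi
    simp only [sub_sub_cancel, show r - (r - s + 1) = s - 1 by ring,
      show r - (r - s - 1) = s + 1 by ring]
    tauto

/-- `q 0, …, q m` is a walk none of whose vertices is major for the hole `f`. -/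
structure NonMajorWalk (G : SimpleGraph V) (f : ℤ → V) (m : ℤ) (q : ℤ → V) : Prop where
  adj : ∀ i, 0 ≤ i → i < m → G.Adj (q i) (q (i + 1))
  nonMajor : ∀ i, 0 ≤ i → i ≤ m → NonMajor G f (q i)

/-- Walks of length `m` avoiding major vertices do not shorten any hole of length `n`. -/
def NoShortcut (G : SimpleGraph V) (n m : ℤ) : Prop :=
  ∀ f, HoleFn G n f → ∀ q, NonMajorWalk G f m q → ∀ x y, x ≤ y → y ≤ x + n →
    q 0 = f x → q m = f y → y - x ≤ m ∨ x + n - y ≤ m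

namespace NonMajorWalk

variable {f q : ℤ → V} {m : ℤ}

lemma sub (h : NonMajorWalk G f m q) {i j : ℤ} (hi : 0 ≤ i) (hj : j ≤ m) :
    NonMajorWalk G f (j - i) (fun s => q (s + i)) := by
  refine ⟨fun s h1 h2 => ?_, fun s h1 h2 => h.nonMajor _ (by omega) (by omega)⟩
  have := h.adj (s + i) (by omega) (by omega)
  rwa [show s + i + 1 = s + 1 + i by ring] at this

lemma reverse (h : NonMajorWalk G f m q) : NonMajorWalk G f m (fun s => q (m - s)) := by
  refine ⟨fun s h1 h2 => ?_, fun s h1 h2 => h.nonMajor _ (by omega) (by omega)⟩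
  have := h.adj (m - (s + 1)) (by omega) (by omega)
  rw [show m - (s + 1) + 1 = m - s by ring] at this
  exact this.symm

lemma shift (h : NonMajorWalk G f m q) (r : ℤ) : NonMajorWalk G (fun i => f (i + r)) m q :=
  ⟨h.adj, fun i h1 h2 => (h.nonMajor i h1 h2).shift r⟩

lemma reflect (h : NonMajorWalk G f m q) (r : ℤ) : NonMajorWalk G (fun i => f (r - i)) m q :=
  ⟨h.adj, fun i h1 h2 => (h.nonMajor i h1 h2).reflect r⟩

end NonMajorWalk

lemma NoShortcut.dist {n m : ℤ} (h : NoShortcut G n m) {f q : ℤ → V} (hf : HoleFn G n f)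
    (hq : NonMajorWalk G f m q) {x y : ℤ} (hxy : x ≤ y + n) (hyx : y ≤ x + n)
    (hx : q 0 = f x) (hy : q m = f y) :
    (x - y ≤ m ∧ y - x ≤ m) ∨ n ≤ m + (x - y) ∨ n ≤ m + (y - x) := by
  rcases le_total x y with hle | hle
  · have := h f hf q hq x y hle hyx hx hy
    omega
  · have := h f hf _ hq.reverse y x hle hxy (by simpa using hy) (by simpa using hx)
    omega

/-- A shortest walk `q 0, …, q (k + 1)` avoiding major vertices that shortens the arc
`f 0, …, f d` of the hole `f`. -/
structure Shortcut (G : SimpleGraph V) (n : ℤ) (f : ℤ → V) (k : ℤ) (q : ℤ → V) (d : ℤ) :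
    Prop where
  hole : HoleFn G n f
  walk : NonMajorWalk G f (k + 1) q
  start_eq : q 0 = f 0
  end_eq : q (k + 1) = f d
  k_nonneg : 0 ≤ k
  lt : k + 1 < d
  le : 2 * d ≤ n
  ind : ∀ m, 0 ≤ m → m < k + 1 → NoShortcut G n m

namespace Shortcut

variable {n k d : ℤ} {f q : ℤ → V} {ℓ : ℕ}

lemma reverse (h : Shortcut G n f k q d) :
    Shortcut G n (fun i => f (d - i)) k (fun i => q (k + 1 - i)) d :=
  ⟨h.hole.reflect d, h.walk.reverse.reflect d, by simpa using h.end_eq, by simpa using h.start_eq,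
    h.k_nonneg, h.lt, h.le, h.ind⟩

lemma mirror (h : Shortcut G n f k q d) (hd : n = 2 * d) :
    Shortcut G n (fun i => f (0 - i)) k q d := by
  refine ⟨h.hole.reflect 0, h.walk.reflect 0, by simpa using h.start_eq, ?_, h.k_nonneg, h.lt,
    h.le, h.ind⟩
  rw [h.end_eq, ← h.hole.sub_period]; congr 1; omega

lemma not_adj (h : Shortcut G n f k q d) {i j : ℤ} (hi : 0 ≤ i) (hij : i + 1 < j)
    (hj : j ≤ k + 1) : ¬ G.Adj (q i) (q j) := by
  intro hadj
  have h1 := h.lt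
  have h2 := h.le
  have hw : NonMajorWalk G f (k + 1 - (j - i - 1))
      (fun s => if s ≤ i then q s else q (s + (j - i - 1))) := by
    refine ⟨fun s h3 h4 => ?_, fun s h3 h4 => ?_⟩
    · rcases lt_trichotomy s i with h5 | rfl | h5
      · simp only [if_pos h5.le, if_pos (show s + 1 ≤ i by omega)]
        exact h.walk.adj s h3 (by omega)
      · simp only [le_refl, if_true, if_neg (show ¬ s + 1 ≤ s by omega)]
        rwa [show s + 1 + (j - s - 1) = j by ring]
      · simp only [if_neg (show ¬ s ≤ i by omega), if_neg (show ¬ s + 1 ≤ i by omega)]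
        have := h.walk.adj (s + (j - i - 1)) (by omega) (by omega)
        rwa [show s + (j - i - 1) + 1 = s + 1 + (j - i - 1) by ring] at this
    · by_cases h5 : s ≤ i
      · simp only [if_pos h5]; exact h.walk.nonMajor s h3 (by omega)
      · simp only [if_neg h5]; exact h.walk.nonMajor _ (by omega) (by omega)
  have := h.ind _ (by omega) (by omega) f h.hole _ hw 0 d (by omega) (by omega)
    (by simpa [hi] using h.start_eq) (by
      simp only [if_neg (show ¬ k + 1 - (j - i - 1) ≤ i by omega), sub_add_cancel, h.end_eq])
  omega

lemma path (h : Shortcut G n f k q d) : IndPath G 0 (k + 1) q := by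
  intro i j h1 h2 h3
  refine ⟨fun heq => ?_, fun hadj => ?_, ?_⟩
  · rcases eq_or_ne j (k + 1) with rfl | h4
    · rcases eq_or_ne i 0 with rfl | h5
      · rw [h.start_eq, h.end_eq] at heq
        have := h.lt
        have := h.le
        exact (h.hole.2.2 0 d (by omega) (by omega)).1 heq
      · have := h.walk.adj (i - 1) (by omega) (by omega)
        rw [sub_add_cancel, heq] at this
        exact h.not_adj (by omega) (by omega) le_rfl this
    · have := h.walk.adj j (by omega) (by omega)
      rw [← heq] at this
      exact h.not_adj h1 (by omega) (by omega) this
  · by_contra hne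
    exact h.not_adj h1 (by omega) h3 hadj
  · rintro rfl
    exact h.walk.adj i h1 (by omega)

lemma off (h : Shortcut G n f k q d) {i : ℤ} (hi : 1 ≤ i) (hik : i ≤ k) (j : ℤ) : q i ≠ f j := by
  intro heq
  obtain ⟨p, h1, h2, h3⟩ := h.hole.exists_window j 0
  rw [h3] at heq
  have h4 := h.lt
  have h5 := h.le
  have h6 := (h.ind (i - 0) (by omega) (by omega)).dist h.hole (h.walk.sub le_rfl (by omega))
    (x := 0) (y := p) (by omega) (by omega) (by simpa using h.start_eq) (by simpa using heq)
  have h7 := (h.ind (k + 1 - i) (by omega) (by omega)).dist h.hole (h.walk.sub (by omega) le_rfl)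
    (x := p) (y := d) (by omega) (by omega) (by simpa using heq) (by simpa using h.end_eq)
  omega

lemma adj_zero (h : Shortcut G n f k q d) : G.Adj (q 1) (f 0) := by
  have := h.walk.adj 0 le_rfl (by have := h.k_nonneg; omega)
  rw [h.start_eq] at this
  exact this.symm

lemma adj_d (h : Shortcut G n f k q d) : G.Adj (q k) (f d) := by
  have := h.walk.adj k h.k_nonneg (by omega)
  rwa [h.end_eq] at this

/-- Neighbours on the hole of two close vertices of a shortcut are close. -/
lemma near (h : Shortcut G n f k q d) {i j p r : ℤ} (hi : 1 ≤ i) (hij : i ≤ j) (hj : j ≤ k)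
    (hlt : j - i < k - 1) (hp : G.Adj (q i) (f p)) (hr : G.Adj (q j) (f r))
    (h1 : p ≤ r + n) (h2 : r ≤ p + n) :
    (p - r ≤ j - i + 2 ∧ r - p ≤ j - i + 2) ∨ n ≤ j - i + 2 + (p - r) ∨
      n ≤ j - i + 2 + (r - p) := by
  have hw : NonMajorWalk G f (j - i + 2)
      (fun s => if s < 1 then f p else if s ≤ j - i + 1 then q (s - 1 + i) else f r) := by
    refine ⟨fun s h3 h4 => ?_, fun s h3 h4 => ?_⟩
    · rcases eq_or_ne s 0 with rfl | h5
      · simpa [show 1 ≤ j - i + 1 by omega] using hp.symm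
      · rcases eq_or_ne s (j - i + 1) with rfl | h6
        · simp only [if_neg (show ¬ j - i + 1 < 1 by omega), le_refl, if_true,
            if_neg (show ¬ j - i + 1 + 1 < 1 by omega),
            if_neg (show ¬ j - i + 1 + 1 ≤ j - i + 1 by omega)]
          rwa [show j - i + 1 - 1 + i = j by ring]
        · simp only [if_neg (show ¬ s < 1 by omega), if_neg (show ¬ s + 1 < 1 by omega),
            if_pos (show s ≤ j - i + 1 by omega), if_pos (show s + 1 ≤ j - i + 1 by omega)]
          have := h.walk.adj (s - 1 + i) (by omega) (by omega)
          rwa [show s - 1 + i + 1 = s + 1 - 1 + i by ring] at this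
    · split_ifs
      · exact Or.inl ⟨_, rfl⟩
      · exact h.walk.nonMajor _ (by omega) (by omega)
      · exact Or.inl ⟨_, rfl⟩
  exact (h.ind _ (by omega) (by omega)).dist h.hole hw h1 h2 (by simp) (by
    simp only [if_neg (show ¬ j - i + 2 < 1 by omega),
      if_neg (show ¬ j - i + 2 ≤ j - i + 1 by omega)])

lemma two_le (h : Shortcut G n f k q d) : 2 ≤ k := by
  have h0 := h.k_nonneg
  have h1 := h.lt
  have h2 := h.le
  by_contra hk
  obtain rfl | rfl : k = 0 ∨ k = 1 := by omega
  · have := h.adj_zero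
    rw [show (1 : ℤ) = 0 + 1 by ring, h.end_eq, G.adj_comm,
      (h.hole.2.2 0 d (by omega) (by omega)).2] at this
    omega
  · obtain ⟨α, γ, h3, h4, h5, -, -, h6⟩ := (h.walk.nonMajor 1 (by omega) (by omega)).exists_span
      h.hole (h.off le_rfl le_rfl) h.adj_zero
    exact h6 d (by omega) (by have := h.hole.1; omega) h.adj_d

lemma exists_middle (h : Shortcut G n f k q d) (hE : Extremal G ℓ n) :
    ∃ b p, 1 < b ∧ b < k ∧ G.Adj (q b) (f p) := by
  by_contra hcon
  push Not at hcon
  have hk := h.two_le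
  have h1 := h.lt
  have h2 := h.le
  have h6 := hE.six_le
  have hn := hE.large
  obtain ⟨α, γ, a1, a2, a3, a4, a5, a6⟩ := (h.walk.nonMajor 1 (by omega) (by omega)).exists_span
    h.hole (h.off le_rfl (by omega)) h.adj_zero
  obtain ⟨α', γ', b1, b2, b3, b4, b5, b6⟩ := (h.walk.nonMajor k (by omega) (by omega)).exists_span
    h.hole (h.off (by omega) le_rfl) h.adj_d
  have hA : Attached G n (fun i => f (i + α)) k q (γ - α) (α' - α) (γ' - α') := by
    refine ⟨h.hole.shift α, h.path.mono (by omega) (by omega), fun i j h3 h4 => h.off h3 h4 _,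
      fun i j h3 h4 => hcon i _ h3 h4, hk, by omega, by omega, by omega, by omega, by omega,
      by omega, by omega, by simpa using a4, by simpa using a5, fun j h3 h4 => ?_,
      by simpa using b4, ?_, fun j h3 h4 => ?_⟩
    · exact a6 _ (by omega) (by omega)
    · simpa [show α' - α + (γ' - α') + α = γ' by ring] using b5
    · exact b6 _ (by omega) (by omega)
  exact hA.false_of_short hE (by omega) (by omega) (by omega)

end Shortcut

namespace Shortcut

variable {n k d : ℤ} {f q : ℤ → V} {ℓ : ℕ}

lemma bounds (h : Shortcut G n f k q d) {b p : ℤ} (hb : 1 < b) (hbk : b < k)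
    (hp0 : 0 ≤ p) (hpd : p ≤ d) (hp : G.Adj (q b) (f p)) :
    (d = k + 3 ∧ p = b + 1) ∨ (d = k + 2 ∧ b ≤ p ∧ p ≤ b + 1) := by
  have h1 := h.lt
  have h2 := h.le
  have h3 := h.near le_rfl hb.le hbk.le (by omega) h.adj_zero hp (by omega) (by omega)
  have h4 := h.near hb.le hbk.le le_rfl (by omega) hp h.adj_d (by omega) (by omega)
  omega

lemma middle_bounds (h : Shortcut G n f k q d) {b p : ℤ} (hb : 1 < b) (hbk : b < k)
    (hp0 : 0 ≤ p) (hpd : p ≤ d) (hp : G.Adj (q b) (f p)) {i j : ℤ} (hi : 1 < i) (hik : i < k)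
    (hj0 : 0 ≤ j) (hjn : j < n) (hj : G.Adj (q i) (f j)) : i ≤ j ∧ j ≤ i + 1 := by
  have h1 := h.lt
  have h2 := h.le
  have h0 := h.bounds hb hbk hp0 hpd hp
  have h3 := h.near le_rfl hi.le hik.le (by omega) h.adj_zero hj (by omega) (by omega)
  have h4 := h.near hi.le hik.le le_rfl (by omega) hj h.adj_d (by omega) (by omega)
  rcases le_total i b with hib | hib
  · have h5 := h.near hi.le hib hbk.le (by omega) hj hp (by omega) (by omega)
    omega
  · have h5 := h.near hb.le hib hik.le (by omega) hp hj (by omega) (by omega)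
    omega

lemma start_bounds (h : Shortcut G n f k q d) {b p : ℤ} (hb : 1 < b) (hbk : b < k)
    (hp0 : 0 ≤ p) (hpd : p ≤ d) (hp : G.Adj (q b) (f p)) {j : ℤ}
    (hj0 : -2 ≤ j) (hjn : j < n - 2) (hj : G.Adj (q 1) (f j)) :
    -1 ≤ j ∧ j ≤ 2 ∧ (j = -1 → p = b) := by
  have h1 := h.lt
  have h2 := h.le
  have h0 := h.bounds hb hbk hp0 hpd hp
  have h3 := h.near le_rfl hb.le hbk.le (by omega) hj hp (by omega) (by omega)
  have h4 : j ≤ 2 := by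
    obtain ⟨α, γ, a1, a2, a3, -, -, a4⟩ :=
      (h.walk.nonMajor 1 (by omega) (by omega)).exists_span h.hole (h.off le_rfl (by omega))
        h.adj_zero
    by_contra hcon
    exact a4 j (by omega) (by omega) hj
  omega

lemma end_bounds (h : Shortcut G n f k q d) {b p : ℤ} (hb : 1 < b) (hbk : b < k)
    (hp0 : 0 ≤ p) (hpd : p ≤ d) (hp : G.Adj (q b) (f p)) {j : ℤ}
    (hj0 : d + 2 - n < j) (hjn : j ≤ d + 2) (hj : G.Adj (q k) (f j)) :
    d - 2 ≤ j ∧ j ≤ d + 1 ∧ (j = d + 1 → p = b + 1) := by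
  have h0 := h.bounds hb hbk hp0 hpd hp
  have h1 := h.reverse.start_bounds (b := k + 1 - b) (p := d - p) (j := d - j) (by omega)
    (by omega) (by omega) (by omega) (by simpa using hp) (by omega) (by omega) (by simpa using hj)
  omega

lemma not_adj_neg_one (h : Shortcut G n f k q d) (hE : Extremal G ℓ n) {b p : ℤ} (hb : 1 < b)
    (hbk : b < k) (hp0 : 0 ≤ p) (hpd : p ≤ d) (hp : G.Adj (q b) (f p)) :
    ¬ G.Adj (q 1) (f (-1)) := by
  intro hadj
  have h1 := h.lt
  have h2 := h.le
  have h6 := hE.six_le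
  have hn := hE.large
  have h0 := h.bounds hb hbk hp0 hpd hp
  have h3 := (h.start_bounds hb hbk hp0 hpd hp (by omega) (by omega) hadj).2.2 rfl
  have e : f (-1 + n) = f (-1) := h.hole.2.1 _
  have key : ∀ i j, 1 ≤ i → i ≤ k → d < j → j < n - 1 → ¬ G.Adj (q i) (f j) := by
    intro i j h4 h5 h6 h7 h8
    rcases h4.eq_or_lt with rfl | h4
    · rcases eq_or_ne j (n - 2) with rfl | h9
      · rw [← h.hole.sub_period] at h8
        have := h.start_bounds hb hbk hp0 hpd hp (by omega) (by omega) h8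
        omega
      · have := h.start_bounds hb hbk hp0 hpd hp (by omega) (by omega) h8
        omega
    · rcases h5.eq_or_lt with rfl | h5
      · rcases le_or_gt j (d + 2) with h9 | h9
        · have := h.end_bounds hb hbk hp0 hpd hp (by omega) h9 h8
          omega
        · rw [← h.hole.sub_period] at h8
          have := h.end_bounds hb hbk hp0 hpd hp (by omega) (by omega) h8
          omega
      · have := h.middle_bounds hb hbk hp0 hpd hp h4 h5 (by omega) (by omega) h8
        omega
  obtain ⟨E, hEp, e₁, e₂⟩ := (h.path.mono (x' := 1) (by omega) le_rfl).cons (a := f (-1)) (by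
    intro i h4 h5
    rcases h5.eq_or_lt with rfl | h5
    · rw [h.end_eq]
      have := h.hole.2.2 (-1) d (by omega) (by omega)
      exact ⟨this.1, this.2.trans ⟨fun _ => by omega, fun _ => by omega⟩⟩
    · refine ⟨(h.off h4 (by omega) _).symm, fun h7 => ?_, ?_⟩
      · by_contra hne
        rcases eq_or_ne i k with rfl | hik
        · have := h.end_bounds hb hbk hp0 hpd hp (by omega) (by omega) h7.symm
          omega
        · rw [← e] at h7
          have := h.middle_bounds hb hbk hp0 hpd hp (by omega) (by omega) (by omega) (by omega)
            h7.symm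
          omega
      · rintro rfl; exact hadj.symm)
  have hD : Detour G n (fun i => f (i + -1)) (d + 1) E (k + 1) := by
    refine ⟨h.hole.shift _, hEp, by simp [e₁], ?_, by omega, by omega, by omega, ?_⟩
    · rw [e₂ _ (by omega), h.end_eq]; congr 1; ring
    · intro i j h4 h5 h7 h8
      rw [e₂ i (by omega)]
      exact ⟨h.off (by omega) (by omega) _, key i _ (by omega) (by omega) (by omega) (by omega)⟩
  refine (hD.short hE (by omega) (by omega)).1 ?_
  rw [show d + 1 = k + 1 + 2 by omega, Int.even_add (n := 2)]
  simp

/-- The vertices of a shortcut are adjacent only to hole vertices of about the same index. -/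
lemma false_of_tame_succ (h : Shortcut G n f k q d) (hE : Extremal G ℓ n) (hd : d = k + 2)
    {b : ℤ} (hb : 1 < b) (hbk : b < k) (hp : G.Adj (q b) (f (b + 1)))
    (tame : ∀ i j, 1 ≤ i → i ≤ k → 0 ≤ j → j < n → G.Adj (q i) (f j) →
      i - 1 ≤ j ∧ (i < k → j ≤ i + 1) ∧ (1 < i → i ≤ j) ∧ j ≤ i + 2) : False := by
  have h2 := h.le
  have h6 := hE.six_le
  have hn := hE.large
  obtain ⟨E, hEp, e₁, e₂⟩ := (h.path.mono (y' := b) le_rfl (by omega)).concat (b := f (b + 1)) (by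
    intro i h4 h5
    rcases h4.eq_or_lt with rfl | h4
    · have := h.hole.2.2 0 (b + 1) (by omega) (by omega)
      rw [h.start_eq]
      exact ⟨this.1, this.2.trans ⟨fun _ => by omega, fun _ => by omega⟩⟩
    · refine ⟨h.off (by omega) (by omega) _, fun h7 => ?_, ?_⟩
      · have := tame i (b + 1) (by omega) (by omega) (by omega) (by omega) h7
        omega
      · rintro rfl; exact hp)
  have hD : Detour G n f (b + 1) E (b + 1) := by
    refine ⟨h.hole, hEp, ?_, e₁, by omega, by omega, by omega, ?_⟩
    · rw [e₂ 0 (by omega), h.start_eq]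
    · intro i j h4 h5 h7 h8
      rw [e₂ i (by omega)]
      refine ⟨h.off (by omega) (by omega) _, fun h9 => ?_⟩
      have := tame i j (by omega) (by omega) (by omega) h8 h9
      omega
  obtain ⟨f', hf', e₃, e₄⟩ := hD.replace (by omega)
  rw [sub_add_cancel] at hf' e₄
  replace e₃ : ∀ i, 0 ≤ i → i ≤ b → f' i = q i := fun i h4 h5 => by
    rw [e₃ i h4 (by omega), e₂ i h5]
  replace e₄ : ∀ i, b + 1 ≤ i → i ≤ n → f' i = f i := fun i h4 h5 => by
    rw [e₄ i h4 h5, sub_add_cancel]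
  have e₅ : ∀ i, n ≤ i → i ≤ n + b → f' i = q (i - n) := fun i h4 h5 => by
    rw [← hf'.sub_period, e₃ (i - n) (by omega) (by omega)]
  have key : ∀ i j, b < i → i ≤ k → b ≤ j → j < b + n → G.Adj (q i) (f' j) →
      i - 1 ≤ j ∧ (i < k → j ≤ i + 1) ∧ j ≤ i + 2 ∧ (i - 1 = j → i = b + 1) := by
    intro i j h4 h5 h7 h8 h9
    rcases h7.eq_or_lt with rfl | h7
    · rw [e₃ b (by omega) le_rfl, G.adj_comm, (h.path b i (by omega) h4 (by omega)).2] at h9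
      omega
    · rcases lt_or_ge j n with h10 | h10
      · rw [e₄ j (by omega) (by omega)] at h9
        have := tame i j (by omega) h5 (by omega) h10 h9
        omega
      · rw [e₅ j h10 (by omega), G.adj_comm,
          (h.path (j - n) i (by omega) (by omega) (by omega)).2] at h9
        omega
  rcases eq_or_ne (b + 1) k with rfl | hbk'
  · have hD' : Detour G n (fun i => f' (i + b)) 3 (fun i => q (i + b)) 2 := by
      refine ⟨hf'.shift _, ?_, ?_, ?_, by omega, by omega, by omega, ?_⟩
      · exact (h.path.shift b).mono (by omega) (by omega)
      · simp only [zero_add]; rw [e₃ b (by omega) le_rfl]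
      · rw [e₄ _ (by omega) (by omega), show 2 + b = b + 1 + 1 by ring, h.end_eq]
        congr 1; omega
      · intro i j h4 h5 h7 h8
        obtain rfl : i = 1 := by omega
        refine ⟨?_, fun h9 => ?_⟩
        · rcases lt_or_ge (j + b) n with h10 | h10
          · rw [e₄ _ (by omega) (by omega)]
            exact h.off (by omega) (by omega) _
          · rw [e₅ _ (by omega) (by omega)]
            exact (h.path (j + b - n) (1 + b) (by omega) (by omega) (by omega)).1.symm
        · have := key (1 + b) (j + b) (by omega) (by omega) (by omega) (by omega) h9
          omega
    have := (hD'.short hE (by omega) (by omega)).2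
    omega
  · have hw : NonMajorWalk G f' (k + 1 - b) (fun s => q (s + b)) := by
      refine ⟨(h.walk.sub (i := b) (by omega) le_rfl).adj, fun s h4 h5 => ?_⟩
      generalize hi : s + b = i
      rcases eq_or_ne i b with rfl | h7
      · exact Or.inl ⟨i, (e₃ i (by omega) le_rfl).symm⟩
      rcases eq_or_ne i (k + 1) with rfl | h8
      · exact Or.inl ⟨d, by rw [h.end_eq, e₄ d (by omega) (by omega)]⟩
      rcases eq_or_ne i k with rfl | h9
      · refine nonMajor_of_window hf' b (i + 1) fun j h10 h11 h12 => ?_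
        have := key i j (by omega) (by omega) h10 h11 h12
        omega
      · refine nonMajor_of_window hf' b i fun j h10 h11 h12 => ?_
        have := key i j (by omega) (by omega) h10 h11 h12
        omega
    have := h.ind _ (by omega) (by omega) f' hf' _ hw b d (by omega) (by omega)
      (by simp only [zero_add]; rw [e₃ b (by omega) le_rfl])
      (by simp only [sub_add_cancel]; rw [h.end_eq, e₄ d (by omega) (by omega)])
    omega

lemma false_of_middle_of_le (h : Shortcut G n f k q d) (hE : Extremal G ℓ n) {b p : ℤ}
    (hb : 1 < b) (hbk : b < k) (hp0 : 0 ≤ p) (hpd : p ≤ d) (hp : G.Adj (q b) (f p)) :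
    False := by
  have h1 := h.lt
  have h2 := h.le
  have h6 := hE.six_le
  have hn := hE.large
  have h0 := h.bounds hb hbk hp0 hpd hp
  have hs := h.not_adj_neg_one hE hb hbk hp0 hpd hp
  have ht : ¬ G.Adj (q k) (f (d + 1)) := by
    have := h.reverse.not_adj_neg_one hE (b := k + 1 - b) (p := d - p) (by omega) (by omega)
      (by omega) (by omega) (by simpa using hp)
    simpa using this
  have hstart : ∀ j, 0 ≤ j → j < n → G.Adj (q 1) (f j) → j ≤ 2 := by
    intro j h3 h4 h5
    rcases lt_or_ge j (n - 2) with h7 | h7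
    · exact (h.start_bounds hb hbk hp0 hpd hp (by omega) h7 h5).2.1
    · rw [← h.hole.sub_period] at h5
      have := h.start_bounds hb hbk hp0 hpd hp (by omega) (by omega) h5
      obtain rfl : j = n - 1 := by omega
      rw [show n - 1 - n = -1 by ring] at h5
      exact absurd h5 hs
  have hend : ∀ j, 0 ≤ j → j < n → G.Adj (q k) (f j) → d - 2 ≤ j ∧ j ≤ d := by
    intro j h3 h4 h5
    rcases le_or_gt j (d + 2) with h7 | h7
    · have := h.end_bounds hb hbk hp0 hpd hp (by omega) h7 h5
      have : j ≠ d + 1 := by rintro rfl; exact ht h5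
      omega
    · rw [← h.hole.sub_period] at h5
      have := h.end_bounds hb hbk hp0 hpd hp (by omega) (by omega) h5
      omega
  have hmid : ∀ i j, 1 < i → i < k → 0 ≤ j → j < n → G.Adj (q i) (f j) → i ≤ j ∧ j ≤ i + 1 :=
    fun i j h3 h4 h5 h7 h8 => h.middle_bounds hb hbk hp0 hpd hp h3 h4 h5 h7 h8
  have tame : ∀ i j, 1 ≤ i → i ≤ k → 0 ≤ j → j < n → G.Adj (q i) (f j) →
      (i = 1 ∧ 0 ≤ j ∧ j ≤ 2) ∨ (i = k ∧ d - 2 ≤ j ∧ j ≤ d) ∨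
        (1 < i ∧ i < k ∧ i ≤ j ∧ j ≤ i + 1) := by
    intro i j h3 h4 h5 h7 h8
    rcases h3.eq_or_lt with rfl | h3
    · exact Or.inl ⟨rfl, h5, hstart j h5 h7 h8⟩
    · rcases h4.eq_or_lt with rfl | h4
      · exact Or.inr (Or.inl ⟨rfl, hend j h5 h7 h8⟩)
      · exact Or.inr (Or.inr ⟨h3, h4, hmid i j h3 h4 h5 h7 h8⟩)
  rcases h0 with ⟨hd, -⟩ | ⟨hd, hpb⟩
  · have hD : Detour G n f d q (k + 1) := by
      refine ⟨h.hole, h.path, h.start_eq, h.end_eq, by omega, by omega, by omega, ?_⟩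
      intro i j h3 h4 h5 h7
      refine ⟨h.off (by omega) (by omega) _, fun h8 => ?_⟩
      have := tame i j (by omega) (by omega) (by omega) h7 h8
      omega
    refine (hD.short hE (by omega) (by omega)).1 ?_
    rw [show d = k + 1 + 2 by omega, Int.even_add (n := 2)]
    simp
  · rcases eq_or_ne p b with rfl | hpb'
    · refine h.reverse.false_of_tame_succ hE hd (b := k + 1 - p) (by omega) (by omega) ?_ ?_
      · have e : d - (k + 1 - p + 1) = p := by omega
        simpa [e] using hp
      · intro i j h3 h4 h5 h7 h8
        rcases le_or_gt j d with h9 | h9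
        · have := tame (k + 1 - i) (d - j) (by omega) (by omega) (by omega) (by omega) h8
          omega
        · rw [← h.hole.2.1] at h8
          have := tame (k + 1 - i) (d - j + n) (by omega) (by omega) (by omega) (by omega) h8
          omega
    · obtain rfl : p = b + 1 := by omega
      refine h.false_of_tame_succ hE hd hb hbk hp fun i j h3 h4 h5 h7 h8 => ?_
      have := tame i j h3 h4 h5 h7 h8
      omega

theorem not_extremal (h : Shortcut G n f k q d) (hE : Extremal G ℓ n) : False := by
  obtain ⟨b, p', hb, hbk, hp'⟩ := h.exists_middle hE
  obtain ⟨p, hp0, hpn, e⟩ := h.hole.exists_window p' 0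
  have hp : G.Adj (q b) (f p) := by rwa [← e]
  rcases le_or_gt p d with hpd | hpd
  · exact h.false_of_middle_of_le hE hb hbk hp0 hpd hp
  · have h1 := h.lt
    have h2 := h.le
    have h3 := h.near le_rfl hb.le hbk.le (by omega) h.adj_zero hp (by omega) (by omega)
    have h4 := h.near hb.le hbk.le le_rfl (by omega) hp h.adj_d (by omega) (by omega)
    obtain ⟨r, hr⟩ := hE.even
    have hnd : n = 2 * d := by omega
    refine (h.mirror hnd).false_of_middle_of_le hE hb hbk (p := n - p) (by omega) (by omega) ?_
    rw [← h.hole.sub_period, show p - n = 0 - (n - p) by ring] at hp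
    exact hp

end Shortcut

theorem Extremal.noShortcut {ℓ : ℕ} {n : ℤ} (hE : Extremal G ℓ n) (m : ℕ) :
    NoShortcut G n m := by
  induction m using Nat.strong_induction_on with
  | _ m ih =>
    intro f hf q hq x y hxy hyx hx hy
    by_contra! hcon
    have hn := hf.1
    have hind : ∀ m' : ℤ, 0 ≤ m' → m' < m → NoShortcut G n m' := by
      intro m' h1 h2
      lift m' to ℕ using h1
      exact ih m' (by omega)
    have hm : (m : ℤ) ≠ 0 := by
      intro hm
      rw [hm, hx] at hy
      exact (hf.2.2 x y (by omega) (by omega)).1 hy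
    rcases le_total (2 * (y - x)) n with hle | hle
    · have hS : Shortcut G n (fun i => f (i + x)) (m - 1) q (y - x) := by
        refine ⟨hf.shift x, ?_, by simpa using hx, by simpa using hy, by omega, by omega, hle,
          fun m' h1 h2 => hind m' h1 (by omega)⟩
        rw [sub_add_cancel]; exact hq.shift x
      exact hS.not_extremal hE
    · have hS : Shortcut G n (fun i => f (x - i)) (m - 1) q (n - (y - x)) := by
        refine ⟨hf.reflect x, ?_, by simpa using hx, ?_, by omega, by omega, by omega,
          fun m' h1 h2 => hind m' h1 (by omega)⟩
        · rw [sub_add_cancel]; exact hq.reflect x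
        · rw [sub_add_cancel, hy, ← hf.sub_period]; congr 1; ring
      exact hS.not_extremal hE

end LEH.Indexed

/-- a shortest long even hole in a candidate has no shortcut. -/
theorem no_shortcut {V : Type*} [Fintype V]
    (ℓ : ℕ) (hℓ : 6 ≤ ℓ) (hℓeven : Even ℓ)
    (G : SimpleGraph V) (hG : Candidate G ℓ)
    {u : V} (c : G.Walk u u) (hc : ShortestLEH G ℓ c) :
    ∀ v w : V, v ∈ c.support → w ∈ c.support → v ≠ w → ¬ G.Adj v w →
      ¬ ∃ Q : G.Walk v w, Q.IsPath ∧ (∀ z ∈ Q.support, ¬ CMajor G c z) ∧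
          Q.length < holeDist G c v w := by
  obtain ⟨f, hf, hs, he⟩ := LEH.Indexed.exists_holeFn hc.1.1
  have hlarge : 2 * ℓ < c.length := by
    by_contra h
    exact hG.1.1 ⟨u, c, hc.1, by omega⟩
  have hE : LEH.Indexed.Extremal G ℓ c.length := by
    refine ⟨hG, hℓ, by exact_mod_cast hc.1.2.2, ?_, fun n' f' hf' hl he' => ?_⟩
    · obtain ⟨k, hk⟩ := hc.1.2.2
      omega
    · obtain ⟨c', hc', hlen, -⟩ := hf'.exists_walk
      have := hc.2 _ c' ⟨hc', by omega, by
        rw [← hlen] at he'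
        exact_mod_cast he'⟩
      omega
  rintro v w hv hw - - ⟨Q, -, hQ, hlt⟩
  obtain ⟨x, rfl⟩ := (hs v).1 hv
  obtain ⟨y', rfl⟩ := (hs w).1 hw
  obtain ⟨y, hxy, hyn, hy⟩ := hf.exists_window y' x
  have hq : LEH.Indexed.NonMajorWalk G f Q.length (fun i => Q.getVert i.toNat) := by
    refine ⟨fun i h0 hi => ?_, fun i _ _ => LEH.Indexed.nonMajor_of_not_cMajor hf hs he
      (hQ _ (Q.getVert_mem_support _))⟩
    have := Q.adj_getVert_succ (i := i.toNat) (by omega)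
    rwa [show i.toNat + 1 = (i + 1).toNat by omega] at this
  have h₁ := LEH.Indexed.holeDist_le hf he hxy
  have h₂ := LEH.Indexed.holeDist_le hf he (x := y) (y := x + c.length) (by omega)
  rw [hf.2.1 x, holeDist, SimpleGraph.dist_comm, ← holeDist] at h₂
  rw [← hy] at h₁ h₂
  rcases hE.noShortcut Q.length f hf _ hq x y hxy (by omega) (by simp) (by simp [hy]) with h | h <;>
    omega
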